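/- arXiv:2604.04587 — 5 statements merged into one kernel-verified Lean document; each statement's English description precedes it below -/
import Mathlib

section
/- Let a be an integer with b = |a| ≥ 2, let k be an integer with 1 ≤ k ≤ b, and let i ≥ 3 be an integer whose odd part is a power of an odd prime, i.e. i = 2^s·r^t for some odd prime r, integers s ≥ 0 and t ≥ 1. Then k·b^{φ(i)} < (k+1)·Φ_i(a). -/
open Polynomial in
/-- For `n = 2 ^ s * r ^ t`, the value `Φ_n(a)` is a quotient `(x ^ r - 1) / (x - 1)`
where `|x|` is a power of `|a|`. -/
theorem exists_eval_cyclotomic_two_pow_mul_prime_pow {r t : ℕ} (hr : r.Prime) (hodd : Odd r)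
    (ht : 1 ≤ t) (s : ℕ) (a : ℤ) (ha : 2 ≤ |a|) :
    ∃ (x : ℤ) (m : ℕ), 1 ≤ m ∧ |x| = |a| ^ m ∧ (2 ^ s * r ^ t).totient = m * (r - 1) ∧
      (cyclotomic (2 ^ s * r ^ t) ℤ).eval a * (x - 1) = x ^ r - 1 := by
  obtain ⟨u, rfl⟩ : ∃ u, t = u + 1 := ⟨t - 1, by omega⟩
  have hu : 1 ≤ r ^ u := Nat.one_le_pow _ _ hr.pos
  have prime_pow_eval (z : ℤ) :
      (cyclotomic (r ^ (u + 1)) ℤ).eval z * (z ^ r ^ u - 1) = (z ^ r ^ u) ^ r - 1 := by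
    have := Fact.mk hr
    have h := congrArg (eval z) (cyclotomic_prime_pow_mul_X_pow_sub_one ℤ r u)
    simpa [pow_succ, pow_mul] using h
  have htot : (r ^ (u + 1)).totient = r ^ u * (r - 1) := Nat.totient_prime_pow_succ hr u
  have hnd : ¬ 2 ∣ r ^ (u + 1) := by
    rw [← even_iff_two_dvd, Nat.not_even_iff_odd]
    exact hodd.pow
  induction s generalizing a with
  | zero =>
    exact ⟨a ^ r ^ u, r ^ u, hu, abs_pow _ _, by simpa using htot, by simpa using prime_pow_eval a⟩
  | succ s ih =>
    rcases Nat.eq_zero_or_pos s with rfl | hs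
    · refine ⟨-a ^ r ^ u, r ^ u, hu, by rw [abs_neg, abs_pow], ?_, ?_⟩
      · rw [zero_add, pow_one, Nat.totient_mul_of_prime_of_not_dvd Nat.prime_two hnd, htot]
        simp
      · have h := congrArg (eval a) (cyclotomic_expand_eq_cyclotomic_mul Nat.prime_two hnd ℤ)
        rw [expand_eval, eval_mul, mul_comm (r ^ (u + 1)) 2] at h
        rw [zero_add, pow_one, hodd.neg_pow]
        have h1 := prime_pow_eval a
        have h2 := prime_pow_eval (a ^ 2)
        rw [h, ← pow_mul a 2, mul_comm 2 (r ^ u), pow_mul] at h2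
        set y := a ^ r ^ u with hy
        have hy0 : y ^ r - 1 ≠ 0 := by
          intro h0
          have habs : 1 < |y ^ r| := by
            rw [abs_pow, hy, abs_pow, ← pow_mul]
            exact one_lt_pow₀ (by omega) (by have := hr.pos; positivity)
          rw [sub_eq_zero.mp h0] at habs
          simp at habs
        apply mul_left_cancel₀ hy0
        linear_combination (y + 1) * eval a (cyclotomic (2 * r ^ (u + 1)) ℤ) * h1 - h2
    · have ha2 : 2 ≤ |a ^ 2| := by rw [abs_pow]; nlinarith
      obtain ⟨x, m, hm, hx, hφ, he⟩ := ih (a ^ 2) ha2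
      have hdvd : 2 ∣ 2 ^ s * r ^ (u + 1) := (dvd_pow_self 2 hs.ne').mul_right _
      refine ⟨x, 2 * m, by omega, by rw [hx, abs_pow, ← pow_mul], ?_, ?_⟩
      · rw [pow_succ', mul_assoc, Nat.totient_mul_of_prime_of_dvd Nat.prime_two hdvd, hφ, mul_assoc]
      · have h := congrArg (eval a) (cyclotomic_expand_eq_cyclotomic Nat.prime_two hdvd ℤ)
        rw [expand_eval] at h
        rw [← he, h, pow_succ', mul_assoc, mul_comm 2]

/-- If `Q = (x ^ r - 1) / (x - 1)` with `r` odd, then `k * |x| ^ (r - 1) < (k + 1) * Q`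
for all `1 ≤ k ≤ |x|`. -/
theorem mul_abs_pow_pred_lt_of_mul_sub_one_eq {r : ℕ} (hodd : Odd r) {k x Q : ℤ}
    (hk : 1 ≤ k) (hkx : k ≤ |x|) (hx : 2 ≤ |x|) (hQ : Q * (x - 1) = x ^ r - 1) :
    k * |x| ^ (r - 1) < (k + 1) * Q := by
  obtain ⟨n, rfl⟩ : ∃ n, r = n + 1 := ⟨r - 1, by have := hodd.pos; omega⟩
  rw [Nat.add_sub_cancel]
  have hpow : 1 ≤ |x| ^ n := one_le_pow₀ (by omega)
  rcases abs_choice x with h | h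
  · rw [h] at hpow hx ⊢
    rw [pow_succ] at hQ
    have hle : x ^ n ≤ Q := by
      refine le_of_mul_le_mul_right ?_ (show 0 < x - 1 by omega)
      linarith
    nlinarith
  · obtain ⟨c, rfl⟩ : ∃ c, x = -c := ⟨-x, by ring⟩
    rw [h, neg_neg] at hpow hx hkx ⊢
    rw [hodd.neg_pow, pow_succ] at hQ
    refine lt_of_mul_lt_mul_right ?_ (show 0 ≤ c + 1 by omega)
    nlinarith [mul_nonneg (sub_nonneg.mpr hkx) (show 0 ≤ c ^ n by omega)]


/-- If `b = |a| ≥ 2`, `1 ≤ k ≤ b` and `i = 2^s·r^t ≥ 3` with `r` an odd prime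
and `t ≥ 1`, then `k·b^{φ(i)} < (k+1)·Φ_i(a)`. -/
theorem cyclotomic_lower_bound_odd_prime_power_part
    (a b : ℤ) (hb : b = |a|) (hb2 : 2 ≤ b)
    (k : ℤ) (hk1 : 1 ≤ k) (hk2 : k ≤ b)
    (i : ℕ) (hi : 3 ≤ i)
    (r s t : ℕ) (hr : r.Prime) (hrodd : Odd r) (ht : 1 ≤ t)
    (hirt : i = 2 ^ s * r ^ t) :
    k * b ^ i.totient < (k + 1) * (Polynomial.cyclotomic i ℤ).eval a := by
  subst hb hirt
  obtain ⟨x, m, hm, hx, hφ, hQ⟩ :=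
    exists_eval_cyclotomic_two_pow_mul_prime_pow hr hrodd ht s a hb2
  have hax : |a| ≤ |x| := hx ▸ le_self_pow₀ (by omega) (by omega)
  rw [hφ, pow_mul, ← hx]
  exact mul_abs_pow_pred_lt_of_mul_sub_one_eq hrodd hk1 (hk2.trans hax) (hb2.trans hax) hQ
end

section
/- Let a be an integer with b = |a| ≥ 2 and let i ≥ 3 be an integer divisible by two distinct odd primes. Then 2·Φ_i(a) > b^{φ(i)}. -/
section

open Finset

theorem one_sub_pow_add_pow_le_prod_Ioc {x : ℝ} (hx0 : 0 < x) (hx : x ≤ 1 / 2) {k n : ℕ}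
    (hkn : k ≤ n) : 1 - x ^ k + x ^ n ≤ ∏ d ∈ Ioc k n, (1 - x ^ d) := by
  induction n, hkn using Nat.le_induction with
  | base => simp
  | succ n hkn ih =>
    rw [prod_Ioc_succ_top (by lia)]
    have hle : x ^ (n + 1) ≤ 1 := pow_le_one₀ hx0.le (by linarith)
    have h1 : x ^ n ≤ x ^ k := pow_le_pow_of_le_one hx0.le (by linarith) hkn
    have h2 : x ^ (n + 1) ≤ x ^ n / 2 := by
      rw [pow_succ]; nlinarith [pow_pos hx0 n]
    have h3 : 0 < x ^ (n + 1) := by positivity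
    nlinarith [mul_le_mul_of_nonneg_right ih (sub_nonneg.2 hle),
      mul_nonneg h3.le (sub_nonneg.2 h1)]

theorem one_sub_pow_lt_prod_one_sub_pow {x : ℝ} (hx0 : 0 < x) (hx : x ≤ 1 / 2) {k n : ℕ}
    {S : Finset ℕ} (hS : ∀ d ∈ S, k < d ∧ d ≤ n) (hkn : k ≤ n) :
    1 - x ^ k < ∏ d ∈ S, (1 - x ^ d) := by
  have key := one_sub_pow_add_pow_le_prod_Ioc hx0 hx hkn
  have hsub : ∏ d ∈ Ioc k n, (1 - x ^ d) ≤ ∏ d ∈ S, (1 - x ^ d) := by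
    refine prod_le_prod_of_subset_of_le_one (fun d hd ↦ mem_Ioc.2 (hS d hd))
      (fun d _ ↦ sub_nonneg.2 (pow_le_one₀ hx0.le (by linarith))) fun d _ _ ↦ ?_
    have : 0 < x ^ d := by positivity
    linarith
  have : 0 < x ^ n := by positivity
  linarith

end

namespace Polynomial

open Finset ArithmeticFunction

theorem eval_cyclotomic_div_pow_totient_eq_prod {b : ℝ} (hb : 1 < b) {n : ℕ} (hn : 0 < n) :
    (cyclotomic n ℝ).eval b / b ^ n.totient =
      ∏ d ∈ n.divisors, (1 - b⁻¹ ^ d) ^ moebius (n / d) := by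
  have hb0 : 0 < b := by linarith
  have h := (prod_eq_iff_prod_pow_moebius_eq_of_nonzero
    (f := fun n ↦ (cyclotomic n ℝ).eval b / b ^ n.totient) (g := fun n ↦ 1 - b⁻¹ ^ n)
    (fun n _ ↦ (div_pos (cyclotomic_pos' n hb) (by positivity)).ne')
    (fun n hn ↦ (sub_pos.2 (pow_lt_one₀ (by positivity) (inv_lt_one_of_one_lt₀ hb)
      hn.ne')).ne')).1 (fun n hn ↦ ?_) n hn
  · rw [← h, Nat.prod_divisorsAntidiagonal' (f := fun i j ↦ (1 - b⁻¹ ^ j) ^ moebius i)]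
  · rw [prod_div_distrib, prod_pow_eq_pow_sum, Nat.sum_totient,
      ← eval_prod, prod_cyclotomic_eq_X_pow_sub_one hn]
    simp only [eval_sub, eval_pow, eval_X, eval_one, inv_pow]
    field_simp

theorem pow_totient_lt_two_mul_eval_cyclotomic_of_squarefree {b : ℝ} (hb : 2 ≤ b) {n : ℕ}
    (hn : 2 ≤ n) (hsq : Squarefree n) :
    b ^ n.totient < 2 * (cyclotomic n ℝ).eval b := by
  have hb0 : 0 < b := by linarith
  have hn0 : n ≠ 0 := by lia
  suffices h : 1 / 2 < (cyclotomic n ℝ).eval b / b ^ n.totient by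
    rw [lt_div_iff₀ (by positivity)] at h
    linarith
  rw [eval_cyclotomic_div_pow_totient_eq_prod (by linarith) (by lia)]
  set x := b⁻¹ with hx
  have hx0 : 0 < x := by positivity
  have hx2 : x ≤ 1 / 2 := by
    rw [hx, one_div]; exact inv_anti₀ two_pos hb
  have hpos : ∀ d ≠ 0, 0 < 1 - x ^ d := fun d hd ↦
    sub_pos.2 (pow_lt_one₀ hx0.le (by linarith) hd)
  have hfac : ∀ S ⊆ n.divisors,
      ∏ d ∈ S, (1 - x ^ d) ≤ ∏ d ∈ S, (1 - x ^ d) ^ moebius (n / d) := by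
    refine fun S hS ↦ prod_le_prod
      (fun d hd ↦ (hpos d (Nat.pos_of_mem_divisors (hS hd)).ne').le) fun d hd ↦ ?_
    have h := zpow_le_zpow_right_of_le_one₀ (hpos d (Nat.pos_of_mem_divisors (hS hd)).ne')
      (by linarith [pow_pos hx0 d]) (le_of_abs_le (abs_moebius_le_one (n := n / d)))
    simpa using h
  have h1 : 1 ∈ n.divisors := by simp [hn0]
  rw [← mul_prod_erase _ _ h1, Nat.div_one, pow_one]
  rcases moebius_ne_zero_iff_eq_or.1 (moebius_ne_zero_iff_squarefree.2 hsq) with hμ | hμ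
  · have hp := Nat.minFac_prime (n := n) (by lia)
    set p := n.minFac with hpdef
    have hpn : p ∣ n := n.minFac_dvd
    have hmem : p ∈ n.divisors.erase 1 := by simp [hn0, hpn, hp.ne_one]
    have hμp : moebius (n / p) = -1 := by
      have hcop : p.Coprime (n / p) :=
        Nat.coprime_of_squarefree_mul (by rwa [Nat.mul_div_cancel' hpn])
      have := isMultiplicative_moebius.map_mul_of_coprime hcop
      rw [Nat.mul_div_cancel' hpn, hμ, moebius_apply_prime hp] at this
      lia
    rw [← mul_prod_erase _ _ hmem, hμ, hμp, zpow_one, zpow_neg_one]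
    have htail := (one_sub_pow_lt_prod_one_sub_pow hx0 hx2 (k := p) (n := n)
      (S := (n.divisors.erase 1).erase p) (fun d hd ↦ by
        simp only [mem_erase, Nat.mem_divisors] at hd
        have hd0 := Nat.pos_of_dvd_of_pos hd.2.2.1 (by lia : 0 < n)
        exact ⟨lt_of_le_of_ne (Nat.minFac_le_of_dvd (by lia) hd.2.2.1) (Ne.symm hd.1),
          Nat.le_of_dvd (by lia) hd.2.2.1⟩) (Nat.le_of_dvd (by lia) hpn)).trans_le
      (hfac _ ((erase_subset _ _).trans (erase_subset _ _)))
    have : 1 < (1 - x ^ p)⁻¹ * ∏ d ∈ (n.divisors.erase 1).erase p,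
        (1 - x ^ d) ^ moebius (n / d) := by
      rwa [← div_eq_inv_mul, one_lt_div (hpos p hp.ne_zero)]
    nlinarith
  · rw [hμ, zpow_neg_one]
    have htail := (one_sub_pow_lt_prod_one_sub_pow hx0 hx2 (k := 1) (n := n)
      (S := n.divisors.erase 1) (fun d hd ↦ by
        simp only [mem_erase, Nat.mem_divisors] at hd
        have hd0 := Nat.pos_of_dvd_of_pos hd.2.1 (by lia : 0 < n)
        exact ⟨by lia, Nat.le_of_dvd (by lia) hd.2.1⟩) (by lia)).trans_le
      (hfac _ (erase_subset _ _))
    rw [pow_one] at htail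
    have : 1 < (1 - x)⁻¹ * ∏ d ∈ n.divisors.erase 1, (1 - x ^ d) ^ moebius (n / d) := by
      rwa [← div_eq_inv_mul, one_lt_div (by linarith)]
    linarith

theorem pow_totient_lt_two_mul_eval_cyclotomic {b : ℝ} (hb : 2 ≤ b) {n : ℕ} (hn : 2 ≤ n) :
    b ^ n.totient < 2 * (cyclotomic n ℝ).eval b := by
  induction n using Nat.strong_induction_on generalizing b with
  | _ n ih =>
  by_cases hsq : Squarefree n
  · exact pow_totient_lt_two_mul_eval_cyclotomic_of_squarefree hb hn hsq
  · rw [Nat.squarefree_iff_prime_squarefree] at hsq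
    push Not at hsq
    obtain ⟨p, hp, m, rfl⟩ := hsq
    have hm : m ≠ 0 := by rintro rfl; simp at hn
    have h := ih (p * m)
      (by nlinarith [hp.two_le, mul_pos hp.pos (Nat.pos_of_ne_zero hm)])
      (b := b ^ p) (hb.trans (le_self_pow₀ (by linarith) hp.ne_zero))
      (by nlinarith [hp.two_le, Nat.pos_of_ne_zero hm])
    rwa [← expand_eval, cyclotomic_expand_eq_cyclotomic hp (dvd_mul_right p m), ← pow_mul,
      ← Nat.totient_mul_of_prime_of_dvd hp (dvd_mul_right p m), mul_comm (p * m) p,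
      ← mul_assoc] at h

theorem primitiveRoots_two_mul_of_odd {n : ℕ} (hn : Odd n) :
    primitiveRoots (2 * n) ℂ = (primitiveRoots n ℂ).map (Equiv.neg ℂ).toEmbedding := by
  symm
  apply eq_of_subset_of_card_le
  · intro z hz
    obtain ⟨w, hw, rfl⟩ := mem_map.1 hz
    have hw := isPrimitiveRoot_of_mem_primitiveRoots hw
    rw [mem_primitiveRoots (by have := hn.pos; lia)]
    have h2 : orderOf (-1 : ℂ) = 2 := by simp [orderOf_neg_one]
    have h := (Commute.all (-1 : ℂ) w).orderOf_mul_eq_mul_orderOf_of_coprime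
      (by rw [h2, ← hw.eq_orderOf]; exact hn.coprime_two_left)
    rw [h2, ← hw.eq_orderOf] at h
    rw [← h]
    simpa using IsPrimitiveRoot.orderOf (-1 * w)
  · rw [card_map, Complex.card_primitiveRoots, Complex.card_primitiveRoots,
      Nat.totient_two_mul_of_odd hn]

theorem eval_cyclotomic_two_mul_of_odd {n : ℕ} (hn : Odd n) (hn2 : 2 < n) (x : ℤ) :
    (cyclotomic (2 * n) ℤ).eval x = (cyclotomic n ℤ).eval (-x) := by
  have hpos : 0 < n := by lia
  have key : (cyclotomic (2 * n) ℂ).eval (x : ℂ) = (cyclotomic n ℂ).eval (-x : ℂ) := by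
    rw [cyclotomic_eq_prod_X_sub_primitiveRoots (Complex.isPrimitiveRoot_exp _ hpos.ne'),
      cyclotomic_eq_prod_X_sub_primitiveRoots
        (Complex.isPrimitiveRoot_exp (2 * n) (by lia)),
      primitiveRoots_two_mul_of_odd hn, prod_map, eval_prod, eval_prod]
    have : ∀ w ∈ primitiveRoots n ℂ,
        (X - C ((Equiv.neg ℂ).toEmbedding w)).eval (x : ℂ) = -(X - C w).eval (-x : ℂ) := by
      intro w _; simp; ring
    rw [prod_congr rfl this, prod_neg, Complex.card_primitiveRoots,
      (Nat.totient_even hn2).neg_one_pow, one_mul]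
  rw [← map_cyclotomic_int, ← map_cyclotomic_int n, ← Int.cast_neg, eval_intCast_map,
    eval_intCast_map] at key
  simpa only [eq_intCast, Int.cast_inj, Int.cast_id] using key

theorem pow_totient_lt_two_mul_eval_cyclotomic_int {b : ℤ} (hb : 2 ≤ b) {n : ℕ}
    (hn : 2 ≤ n) : b ^ n.totient < 2 * (cyclotomic n ℤ).eval b := by
  have h := pow_totient_lt_two_mul_eval_cyclotomic (b := b) (by exact_mod_cast hb) hn
  rw [← map_cyclotomic_int, eval_intCast_map, eq_intCast] at h
  exact_mod_cast h

theorem pow_totient_lt_two_mul_eval_neg_cyclotomic_int {b : ℤ} (hb : 2 ≤ b) {n : ℕ}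
    (hn : 3 ≤ n) : b ^ n.totient < 2 * (cyclotomic n ℤ).eval (-b) := by
  rcases Nat.even_or_odd' n with ⟨m, rfl | hm⟩
  · rcases Nat.even_or_odd m with hm | hm
    · have h := pow_totient_lt_two_mul_eval_cyclotomic_int hb (n := 2 * m) (by lia)
      rw [mul_comm 2 m, ← cyclotomic_expand_eq_cyclotomic Nat.prime_two hm.two_dvd,
        expand_eval] at h ⊢
      rwa [neg_sq]
    · have hm2 : 2 < m := by
        obtain ⟨k, rfl⟩ := hm
        lia
      rw [eval_cyclotomic_two_mul_of_odd hm hm2, neg_neg, Nat.totient_two_mul_of_odd hm]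
      exact pow_totient_lt_two_mul_eval_cyclotomic_int hb (by lia)
  · have hodd : Odd n := ⟨m, hm⟩
    rw [← eval_cyclotomic_two_mul_of_odd hodd (by lia), ← Nat.totient_two_mul_of_odd hodd]
    exact pow_totient_lt_two_mul_eval_cyclotomic_int hb (by lia)

end Polynomial

/-- If `b = |a| ≥ 2` and `i ≥ 3` is divisible by two distinct odd primes, then
`2·Φ_i(a) > b^{φ(i)}`. -/
theorem cyclotomic_lower_bound_two_odd_primes
    (a b : ℤ) (hb : b = |a|) (hb2 : 2 ≤ b)
    (i : ℕ) (hi : 3 ≤ i)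
    (r s : ℕ) (hr : r.Prime) (hs : s.Prime) (hrodd : Odd r) (hsodd : Odd s)
    (hrs : r ≠ s) (hri : r ∣ i) (hsi : s ∣ i) :
    b ^ i.totient < 2 * (Polynomial.cyclotomic i ℤ).eval a := by
  rcases abs_choice a with h | h
  · rw [← h, ← hb]
    exact Polynomial.pow_totient_lt_two_mul_eval_cyclotomic_int hb2 (by lia)
  · obtain rfl : a = -b := by lia
    exact Polynomial.pow_totient_lt_two_mul_eval_neg_cyclotomic_int hb2 hi
end

section
/- Let a be an integer with b = |a| ≥ 2 and let i be an integer with 3 ≤ i < 105. Then b^{φ(i)} < 2·Φ_i(a) and Φ_i(a) < 2·b^{φ(i)}. -/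
open Polynomial ArithmeticFunction in
/-- Möbius inversion for the normalized cyclotomic values `Φ_n(a) / a ^ φ(n)`. -/
theorem cyclotomic_eval_div_pow_totient_eq_prod {a : ℝ} (ha : 1 < |a|) {n : ℕ} (hn : 0 < n) :
    (cyclotomic n ℝ).eval a / a ^ n.totient =
      ∏ d ∈ n.divisors, (1 - a⁻¹ ^ d) ^ moebius (n / d) := by
  have ha0 : a ≠ 0 := by
    rintro rfl
    norm_num at ha
  have hpow : ∀ m : ℕ, 0 < m → a ^ m - 1 ≠ 0 := by
    intro m hm h
    have h1 : |a| ^ m = 1 := by rw [← abs_pow, sub_eq_zero.mp h, abs_one]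
    exact (one_lt_pow₀ ha hm.ne').ne' h1
  have hprod : ∀ m : ℕ, 0 < m → ∏ d ∈ m.divisors, (cyclotomic d ℝ).eval a = a ^ m - 1 := by
    intro m hm
    rw [← eval_prod, prod_cyclotomic_eq_X_pow_sub_one hm]
    simp
  have hne : ∀ m : ℕ, 0 < m → (cyclotomic m ℝ).eval a ≠ 0 := by
    intro m hm h
    refine hpow m hm ?_
    rw [← hprod m hm]
    exact Finset.prod_eq_zero (Nat.mem_divisors_self m hm.ne') h
  have hsub : ∀ m : ℕ, 1 - a⁻¹ ^ m = (a ^ m - 1) / a ^ m := by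
    intro m
    rw [inv_pow]
    field_simp
  have key := (prod_eq_iff_prod_pow_moebius_eq_of_nonzero
    (f := fun m => (cyclotomic m ℝ).eval a / a ^ m.totient) (g := fun m => 1 - a⁻¹ ^ m)
    (fun m hm => div_ne_zero (hne m hm) (pow_ne_zero _ ha0))
    (fun m hm => by
      rw [hsub]
      exact div_ne_zero (hpow m hm) (pow_ne_zero _ ha0))).1
    (fun m hm => by
      rw [Finset.prod_div_distrib, hprod m hm, Finset.prod_pow_eq_pow_sum, Nat.sum_totient, hsub])
    n hn
  rw [← key, Nat.prod_divisorsAntidiagonal' (fun i j => (1 - a⁻¹ ^ j) ^ moebius i)]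

theorem sum_pow_lt_pow_of_le_half {t : ℝ} (ht : 0 < t) (ht2 : t ≤ 1 / 2) {k : ℕ} {S : Finset ℕ}
    (hS : ∀ d ∈ S, k < d) : ∑ d ∈ S, t ^ d < t ^ k := by
  have hIoc : ∀ m : ℕ, ∑ d ∈ Finset.Ioc k (k + m), t ^ d ≤ t ^ k - t ^ (k + m) := by
    intro m
    induction m with
    | zero => simp
    | succ m ih =>
      rw [← add_assoc, Finset.sum_Ioc_succ_top (by omega)]
      have : t ^ (k + m + 1) ≤ t ^ (k + m) * (1 / 2) := by
        rw [pow_succ]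
        gcongr
      linarith
  have hsub : S ⊆ Finset.Ioc k (k + S.sup id) := by
    intro d hd
    have : d ≤ S.sup id := Finset.le_sup (f := id) hd
    have := hS d hd
    simp only [Finset.mem_Ioc]
    omega
  have h1 := Finset.sum_le_sum_of_subset_of_nonneg hsub
    (f := fun d => t ^ d) (fun d _ _ => by positivity)
  have h2 := hIoc (S.sup id)
  have h3 : 0 < t ^ (k + S.sup id) := by positivity
  linarith

theorem one_sub_sum_le_prod_of_one_sub_le {ι : Type*} (S : Finset ι) (f g : ι → ℝ)
    (hf0 : ∀ i ∈ S, 0 ≤ f i) (hf1 : ∀ i ∈ S, f i ≤ 1) (hg : ∀ i ∈ S, 1 - f i ≤ g i) :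
    1 - ∑ i ∈ S, f i ≤ ∏ i ∈ S, g i := by
  classical
  have h : 1 - ∑ i ∈ S, f i ≤ ∏ i ∈ S, (1 - f i) := by
    induction S using Finset.induction_on with
    | empty => simp
    | insert i S hi ih =>
      rw [Finset.sum_insert hi, Finset.prod_insert hi]
      simp only [Finset.mem_insert, forall_eq_or_imp] at hf0 hf1 hg
      have h1 := ih hf0.2 hf1.2 hg.2
      have h2 : 0 ≤ ∑ i ∈ S, f i := Finset.sum_nonneg hf0.2
      nlinarith [mul_le_mul_of_nonneg_left h1 (sub_nonneg.2 hf1.1), mul_nonneg hf0.1 h2]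
  exact h.trans (Finset.prod_le_prod (fun i hi => sub_nonneg.2 (hf1 i hi)) hg)

theorem one_sub_pow_pos_of_abs_le_half {x : ℝ} (hx : |x| ≤ 1 / 2) {d : ℕ} (hd : 0 < d) :
    0 < 1 - x ^ d := by
  have h : |x ^ d| < 1 := by
    rw [abs_pow]
    exact pow_lt_one₀ (abs_nonneg x) (by linarith) hd.ne'
  linarith [(abs_lt.1 h).2]

theorem one_sub_abs_pow_le_zpow {x : ℝ} (hx : |x| ≤ 1 / 2) {d : ℕ} (hd : 0 < d) {e : ℤ}
    (he : |e| ≤ 1) : 1 - |x| ^ d ≤ (1 - x ^ d) ^ e := by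
  have hpos := one_sub_pow_pos_of_abs_le_half hx hd
  have h := abs_le.1 (abs_pow x d).le
  have h0 : 0 ≤ |x| ^ d := by positivity
  have hpos' := one_sub_pow_pos_of_abs_le_half (x := |x|) (by rwa [abs_abs]) hd
  obtain ⟨he1, he2⟩ := abs_le.1 he
  interval_cases e
  · rw [zpow_neg_one, le_inv_comm₀ hpos' hpos, ← one_div, le_div_iff₀ hpos']
    nlinarith [mul_nonneg h0 h0]
  · simp
  · rw [zpow_one]
    linarith

theorem one_sub_abs_pow_lt_prod {x : ℝ} (hx0 : x ≠ 0) (hx : |x| ≤ 1 / 2) {k : ℕ} {S : Finset ℕ}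
    (hS : ∀ d ∈ S, k < d) {e : ℕ → ℤ} (he : ∀ d, |e d| ≤ 1) :
    1 - |x| ^ k < ∏ d ∈ S, (1 - x ^ d) ^ e d := by
  have h1 := sum_pow_lt_pow_of_le_half (abs_pos.2 hx0) hx hS
  have h2 := one_sub_sum_le_prod_of_one_sub_le S (fun d => |x| ^ d)
    (fun d => (1 - x ^ d) ^ e d) (fun d _ => by positivity)
    (fun d _ => pow_le_one₀ (abs_nonneg x) (by linarith))
    (fun d hd => one_sub_abs_pow_le_zpow hx (by have := hS d hd; omega) (he d))
  linarith

theorem prod_mul_one_sub_abs_pow_lt_one {x : ℝ} (hx0 : x ≠ 0) (hx : |x| ≤ 1 / 2) {k : ℕ}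
    {S : Finset ℕ} (hS : ∀ d ∈ S, k < d) {e : ℕ → ℤ} (he : ∀ d, |e d| ≤ 1) :
    (∏ d ∈ S, (1 - x ^ d) ^ e d) * (1 - |x| ^ k) < 1 := by
  have hpos : 0 < ∏ d ∈ S, (1 - x ^ d) ^ e d := Finset.prod_pos fun d hd =>
    zpow_pos (one_sub_pow_pos_of_abs_le_half hx (by have := hS d hd; omega)) _
  have h := one_sub_abs_pow_lt_prod hx0 hx hS (e := fun d => -e d) (by simpa using he)
  simp only [zpow_neg, Finset.prod_inv_distrib] at h
  calc _ < (∏ d ∈ S, (1 - x ^ d) ^ e d) * (∏ d ∈ S, (1 - x ^ d) ^ e d)⁻¹ := by gcongr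
    _ = 1 := mul_inv_cancel₀ hpos.ne'

open Polynomial in
theorem cyclotomic_two_mul_eq_comp_neg_X {m : ℕ} (hm : Odd m) (hm2 : 2 < m) :
    cyclotomic (2 * m) ℤ = (cyclotomic m ℤ).comp (-X) := by
  have hζ := Complex.isPrimitiveRoot_exp m (by omega)
  set ζ := Complex.exp (2 * Real.pi * Complex.I / m)
  have hneg : IsPrimitiveRoot (-ζ) (2 * m) := by
    have h1 : orderOf (-1 : ℂ) = 2 := by simp [orderOf_neg_one, ringChar.eq_zero]
    have h := (Commute.all (-1 : ℂ) ζ).orderOf_mul_eq_mul_orderOf_of_coprime (by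
      rw [h1, ← hζ.eq_orderOf]
      exact (Nat.coprime_two_left).2 hm)
    rw [h1, ← hζ.eq_orderOf, neg_one_mul] at h
    exact h ▸ IsPrimitiveRoot.orderOf (-ζ)
  have hmonic : ((cyclotomic m ℤ).comp (-X)).Monic := by
    have h := (cyclotomic.monic m ℤ).neg_one_pow_natDegree_mul_comp_neg_X
    rwa [natDegree_cyclotomic, (Nat.totient_even hm2).neg_one_pow, one_mul] at h
  refine (eq_of_monic_of_dvd_of_natDegree_le (cyclotomic.monic _ ℤ) hmonic ?_ ?_).symm
  · rw [cyclotomic_eq_minpoly hneg (by omega)]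
    refine minpoly.isIntegrallyClosed_dvd (hneg.isIntegral (by omega)) ?_
    rw [aeval_comp]
    have h := hζ.isRoot_cyclotomic (by omega)
    rw [IsRoot.def, ← map_cyclotomic_int, eval_map] at h
    simpa [aeval_def] using h
  · rw [natDegree_comp, natDegree_neg, natDegree_X, mul_one, natDegree_cyclotomic,
      natDegree_cyclotomic, Nat.totient_two_mul_of_odd hm]

theorem abs_inv_le_half {a : ℝ} (ha : 2 ≤ |a|) : |a⁻¹| ≤ 1 / 2 := by
  rw [abs_inv, one_div]
  exact inv_anti₀ two_pos ha

theorem ne_zero_of_two_le_abs {a : ℝ} (ha : 2 ≤ |a|) : a ≠ 0 := by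
  rintro rfl
  norm_num at ha

open Polynomial ArithmeticFunction in
theorem cyclotomic_eval_div_pow_totient_bounds_of_not_squarefree {a : ℝ} (ha : 2 ≤ |a|) {n : ℕ}
    (hn : 0 < n) (hsq : ¬Squarefree n) :
    1 / 2 < (cyclotomic n ℝ).eval a / a ^ n.totient ∧
      (cyclotomic n ℝ).eval a / a ^ n.totient < 2 := by
  have hx := abs_inv_le_half ha
  have hx0 : a⁻¹ ≠ 0 := inv_ne_zero (ne_zero_of_two_le_abs ha)
  rw [cyclotomic_eval_div_pow_totient_eq_prod (by linarith) hn,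
    ← Finset.mul_prod_erase _ _ (Nat.one_mem_divisors.2 hn.ne'), Nat.div_one,
    moebius_eq_zero_of_not_squarefree hsq, zpow_zero, one_mul]
  have hS : ∀ d ∈ n.divisors.erase 1, 1 < d := by
    intro d hd
    obtain ⟨h1, h2⟩ := Finset.mem_erase.1 hd
    have := Nat.pos_of_mem_divisors h2
    omega
  have he : ∀ d, |moebius (n / d)| ≤ 1 := fun d => abs_moebius_le_one
  have h1 := one_sub_abs_pow_lt_prod hx0 hx hS he
  have h2 := prod_mul_one_sub_abs_pow_lt_one hx0 hx hS he
  rw [pow_one] at h1 h2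
  constructor <;> nlinarith

open Polynomial ArithmeticFunction in
theorem cyclotomic_eval_div_pow_totient_bounds_of_odd {a : ℝ} (ha : 2 ≤ |a|) (hneg : a < 0) {n : ℕ}
    (hn : Odd n) :
    1 / 2 < (cyclotomic n ℝ).eval a / a ^ n.totient ∧
      (cyclotomic n ℝ).eval a / a ^ n.totient < 2 := by
  have hx := abs_inv_le_half ha
  have hx0 : a⁻¹ < 0 := inv_lt_zero.2 hneg
  have hn0 := hn.pos
  rw [cyclotomic_eval_div_pow_totient_eq_prod (by linarith) hn0,
    ← Finset.mul_prod_erase _ _ (Nat.one_mem_divisors.2 hn0.ne'), Nat.div_one, pow_one]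
  have hS : ∀ d ∈ n.divisors.erase 1, 2 < d := by
    intro d hd
    obtain ⟨h1, h2⟩ := Finset.mem_erase.1 hd
    obtain ⟨k, hk⟩ := hn.of_dvd_nat (Nat.dvd_of_mem_divisors h2)
    omega
  have he : ∀ d, |moebius (n / d)| ≤ 1 := fun d => abs_moebius_le_one
  have h1 := one_sub_abs_pow_lt_prod hx0.ne hx hS he
  have h2 := prod_mul_one_sub_abs_pow_lt_one hx0.ne hx hS he
  set R := ∏ d ∈ n.divisors.erase 1, (1 - a⁻¹ ^ d) ^ moebius (n / d)
  have hsq : |a⁻¹| ^ 2 ≤ 1 / 4 := by nlinarith [abs_nonneg a⁻¹]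
  have hR1 : 3 / 4 < R := by linarith
  have hR2 : R < 4 / 3 := by nlinarith
  have hx1 := (abs_le.1 hx).1
  have hb1 : 2 / 3 ≤ (1 - a⁻¹) ^ moebius n := by
    obtain ⟨h1, h2⟩ := abs_le.1 (abs_moebius_le_one (n := n))
    generalize moebius n = e at *
    interval_cases e
    · rw [zpow_neg_one, le_inv_comm₀ (by norm_num) (by linarith)]
      linarith
    · norm_num
    · rw [zpow_one]
      linarith
  have hb2 : (1 - a⁻¹) ^ moebius n ≤ 3 / 2 := by
    obtain ⟨h1, h2⟩ := abs_le.1 (abs_moebius_le_one (n := n))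
    generalize moebius n = e at *
    interval_cases e
    · rw [zpow_neg_one, inv_le_comm₀ (by linarith) (by norm_num)]
      linarith
    · norm_num
    · rw [zpow_one]
      linarith
  constructor <;> nlinarith

open Polynomial ArithmeticFunction in
theorem cyclotomic_eval_div_pow_totient_bounds_of_pos {a : ℝ} (ha : 2 ≤ a) {n : ℕ}
    (hn : 1 < n) (hsq : Squarefree n) :
    1 / 2 < (cyclotomic n ℝ).eval a / a ^ n.totient ∧
      (cyclotomic n ℝ).eval a / a ^ n.totient < 2 := by
  have ha' : 2 ≤ |a| := ha.trans (le_abs_self a)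
  have hx := abs_inv_le_half ha'
  have hx0 : 0 < a⁻¹ := by positivity
  have hp : n.minFac.Prime := Nat.minFac_prime hn.ne'
  have hp2 := hp.two_le
  have hmem : n.minFac ∈ n.divisors.erase 1 :=
    Finset.mem_erase.2 ⟨hp.ne_one, Nat.mem_divisors.2 ⟨n.minFac_dvd, by omega⟩⟩
  have hμ : moebius (n / n.minFac) = -moebius n := by
    have hmul := Nat.mul_div_cancel' n.minFac_dvd
    have hcop : n.minFac.Coprime (n / n.minFac) := by
      rw [← hmul] at hsq
      exact Nat.coprime_of_squarefree_mul hsq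
    have h := isMultiplicative_moebius.map_mul_of_coprime hcop
    rw [hmul, moebius_apply_prime hp] at h
    omega
  rw [cyclotomic_eval_div_pow_totient_eq_prod (by linarith) (by omega),
    ← Finset.mul_prod_erase _ _ (Nat.one_mem_divisors.2 (by omega)), Nat.div_one, pow_one,
    ← Finset.mul_prod_erase _ _ hmem, hμ]
  have hS : ∀ d ∈ (n.divisors.erase 1).erase n.minFac, n.minFac < d := by
    intro d hd
    simp only [Finset.mem_erase, Nat.mem_divisors] at hd
    have hd0 : d ≠ 0 := by
      rintro rfl
      exact hd.2.2.2 (zero_dvd_iff.1 hd.2.2.1)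
    exact lt_of_le_of_ne (Nat.minFac_le_of_dvd (by omega) hd.2.2.1) (Ne.symm hd.1)
  have he : ∀ d, |moebius (n / d)| ≤ 1 := fun d => abs_moebius_le_one
  have h1 := one_sub_abs_pow_lt_prod hx0.ne' hx hS he
  have h2 := prod_mul_one_sub_abs_pow_lt_one hx0.ne' hx hS he
  set R := ∏ d ∈ (n.divisors.erase 1).erase n.minFac, (1 - a⁻¹ ^ d) ^ moebius (n / d)
  rw [abs_of_pos hx0] at h1 h2 hx
  generalize a⁻¹ = x at *
  have hy0 : 0 < x ^ n.minFac := by positivity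
  have hy : x ^ n.minFac ≤ x ^ 2 := pow_le_pow_of_le_one hx0.le (by linarith) hp2
  generalize x ^ n.minFac = y at *
  have hy4 : y ≤ 1 / 4 := by nlinarith
  have hR : 0 < R := by linarith
  have h1y : 0 < 1 - y := by linarith
  have h1x : 0 < 1 - x := by linarith
  rcases (moebius_ne_zero_iff_eq_or).1 (moebius_ne_zero_iff_squarefree.2 hsq) with h | h
  · rw [h, zpow_one, zpow_neg_one]
    have e : (1 - x) * ((1 - y)⁻¹ * R) = (1 - x) * R / (1 - y) := by field_simp
    rw [e, lt_div_iff₀ h1y, div_lt_iff₀ h1y]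
    constructor <;> nlinarith
  · rw [h, neg_neg, zpow_one, zpow_neg_one]
    have e : (1 - x)⁻¹ * ((1 - y) * R) = (1 - y) * R / (1 - x) := by field_simp
    rw [e, lt_div_iff₀ h1x, div_lt_iff₀ h1x]
    constructor <;> nlinarith

open Polynomial in
/-- The normalized values `Φ_n(a) / a ^ φ(n)` lie strictly between `1 / 2` and `2`. -/
theorem cyclotomic_eval_div_pow_totient_bounds {a : ℝ} (ha : 2 ≤ |a|) {n : ℕ} (hn : 2 < n) :
    1 / 2 < (cyclotomic n ℝ).eval a / a ^ n.totient ∧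
      (cyclotomic n ℝ).eval a / a ^ n.totient < 2 := by
  by_cases hsq : Squarefree n
  swap
  · exact cyclotomic_eval_div_pow_totient_bounds_of_not_squarefree ha (by omega) hsq
  rcases le_abs.1 ha with hpos | hneg
  · exact cyclotomic_eval_div_pow_totient_bounds_of_pos hpos (by omega) hsq
  rcases Nat.even_or_odd' n with ⟨m, rfl | rfl⟩
  swap
  · exact cyclotomic_eval_div_pow_totient_bounds_of_odd ha (by linarith) ⟨m, rfl⟩
  have hodd : Odd m := Nat.coprime_two_left.1 (Nat.coprime_of_squarefree_mul hsq)
  have hm2 : 2 < m := by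
    obtain ⟨k, rfl⟩ := hodd
    omega
  have heval : (cyclotomic (2 * m) ℝ).eval a = (cyclotomic m ℝ).eval (-a) := by
    rw [← map_cyclotomic_int, cyclotomic_two_mul_eq_comp_neg_X hodd hm2, Polynomial.map_comp,
      map_cyclotomic_int]
    simp
  rw [heval, Nat.totient_two_mul_of_odd hodd, ← (Nat.totient_even hm2).neg_pow a]
  exact cyclotomic_eval_div_pow_totient_bounds_of_pos hneg (by omega)
    (hsq.squarefree_of_dvd (dvd_mul_left m 2))

/-- If `b = |a| ≥ 2` and `3 ≤ i < 105`, then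
`b^{φ(i)} < 2·Φ_i(a)` and `Φ_i(a) < 2·b^{φ(i)}`. -/
theorem cyclotomic_two_sided_bound_small_index
    (a b : ℤ) (hb : b = |a|) (hb2 : 2 ≤ b)
    (i : ℕ) (hi1 : 3 ≤ i) (hi2 : i < 105) :
    b ^ i.totient < 2 * (Polynomial.cyclotomic i ℤ).eval a ∧
    (Polynomial.cyclotomic i ℤ).eval a < 2 * b ^ i.totient := by
  subst hb
  have ha : (2 : ℝ) ≤ |(a : ℝ)| := by exact_mod_cast hb2
  have heven : Even i.totient := Nat.totient_even hi1
  have hpow : (0 : ℝ) < (a : ℝ) ^ i.totient := heven.pow_pos (ne_zero_of_two_le_abs ha)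
  obtain ⟨h1, h2⟩ := cyclotomic_eval_div_pow_totient_bounds ha hi1
  have hcast : (Polynomial.cyclotomic i ℝ).eval (a : ℝ) =
      (((Polynomial.cyclotomic i ℤ).eval a : ℤ) : ℝ) :=
    Polynomial.cyclotomic.eval_apply a i (Int.castRingHom ℝ)
  rw [hcast, lt_div_iff₀ hpow] at h1
  rw [hcast, div_lt_iff₀ hpow] at h2
  rw [heven.pow_abs]
  constructor
  · have : (a : ℝ) ^ i.totient < 2 * (((Polynomial.cyclotomic i ℤ).eval a : ℤ) : ℝ) := by linarith
    exact_mod_cast this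
  · exact_mod_cast h2
end

section
/- (Bang–Zsigmondy) Let a be an integer with |a| > 1 and let i be a positive integer such that (a,i) ∉ {(2,1),(2,6),(−2,2),(−2,3),(3,1),(−3,2)}. Then there exists a prime r with e(r,a) = i, where for an odd prime r not dividing a, e(r,a) is the multiplicative order of a modulo r, and e(2,a) is defined to be 1 if 4 divides a−1 and to be 2 if 4 divides a+1. -/
/-- `e r a`: for an odd prime `r`, the multiplicative order of `a` modulo `r`
(which is `0` when `r` divides `a`); for `r = 2` it is `1` if `4 ∣ a - 1`,
`2` if `4 ∣ a + 1`, and `0` otherwise. -/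
noncomputable def e (r : ℕ) (a : ℤ) : ℕ :=
  if r = 2 then (if (4 : ℤ) ∣ a - 1 then 1 else if (4 : ℤ) ∣ a + 1 then 2 else 0)
  else orderOf ((a : ZMod r))

open Polynomial in
/-- If a prime `p` divides `Φ_{p ^ k * m}(a)` with `p ∤ m`, then `a` has order `m` modulo `p`. -/
theorem isPrimitiveRoot_of_prime_dvd_cyclotomic_eval {p k m : ℕ} (hp : p.Prime) (hm : ¬p ∣ m)
    {a : ℤ} (h : (p : ℤ) ∣ (cyclotomic (p ^ k * m) ℤ).eval a) :
    IsPrimitiveRoot (a : ZMod p) m := by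
  have : Fact p.Prime := ⟨hp⟩
  have : NeZero (m : ZMod p) := ⟨by rwa [Ne, ZMod.natCast_eq_zero_iff]⟩
  refine (isRoot_cyclotomic_prime_pow_mul_iff_of_charP (p := p) (k := k)).1 ?_
  rw [IsRoot.def, ← map_cyclotomic_int, eval_intCast_map]
  simpa using (ZMod.intCast_zmod_eq_zero_iff_dvd _ p).2 h

theorem IsPrimitiveRoot.dvd_prime_sub_one {p m : ℕ} (hp : p.Prime) (hm : m ≠ 0) {x : ZMod p}
    (h : IsPrimitiveRoot x m) : m ∣ p - 1 := by
  have : Fact p.Prime := ⟨hp⟩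
  exact h.dvd_of_pow_eq_one _ (ZMod.pow_card_sub_one_eq_one (h.isUnit hm).ne_zero)

/-- If `p` is an odd prime and `b ≡ 1` modulo `p`, then `p ^ 2` does not divide
`1 + b + ⋯ + b ^ (p - 1)`. -/
theorem not_sq_dvd_geom_sum {p : ℕ} (hp : p.Prime) (hodd : Odd p) {b : ℤ} (hb : (p : ℤ) ∣ b - 1) :
    ¬(p : ℤ) ^ 2 ∣ ∑ j ∈ Finset.range p, b ^ j := by
  intro h
  obtain ⟨c, hc⟩ := hb
  obtain rfl : b = 1 + p * c := by linarith
  have h1 := odd_sq_dvd_geom_sum₂_sub (1 : ℤ) c hodd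
  simp only [one_pow, mul_one] at h1
  have h2 : (p : ℤ) ^ 2 ∣ p := (dvd_sub_right h).1 h1
  have h3 : p ^ 2 ∣ p := by exact_mod_cast h2
  have := Nat.le_of_dvd hp.pos h3
  nlinarith [hp.two_le]

open Polynomial in
theorem not_sq_dvd_cyclotomic_eval {p n : ℕ} (hp : p.Prime) (hn : 3 ≤ n) (hpn : p ∣ n) {a : ℕ}
    (ha : 2 ≤ a) : ¬(p : ℤ) ^ 2 ∣ (cyclotomic n ℤ).eval (a : ℤ) := by
  intro h
  obtain ⟨k, m, hm, rfl⟩ := Nat.exists_eq_pow_mul_and_not_dvd (n := n) (by lia) p hp.ne_one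
  have hm0 : m ≠ 0 := by rintro rfl; simp at hm
  have hroot := isPrimitiveRoot_of_prime_dvd_cyclotomic_eval hp hm
    ((dvd_pow_self (p : ℤ) two_ne_zero).trans h)
  obtain _ | k := k
  · simp [hm] at hpn
  rcases hp.eq_two_or_odd' with rfl | hodd
  · obtain rfl : m = 1 := by simpa using hroot.dvd_prime_sub_one hp hm0
    obtain _ | k := k
    · simp at hn
    rw [mul_one, cyclotomic_prime_pow_eq_geom_sum hp] at h
    simp only [Finset.sum_range_succ, Finset.sum_range_zero, eval_add, pow_zero, pow_one, eval_one,
      zero_add, eval_pow, eval_X] at h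
    rw [pow_succ 2 k, pow_mul] at h
    generalize ((a : ℤ) ^ 2 ^ k) = x at h
    rcases Int.even_or_odd' x with ⟨y, rfl | rfl⟩ <;> ring_nf at h <;> lia
  · set b : ℤ := (a : ℤ) ^ (p ^ k * m) with hb
    have hbp : (p : ℤ) ∣ b - 1 := by
      rw [← ZMod.intCast_zmod_eq_zero_iff_dvd, hb]
      have h1 := hroot.pow_eq_one
      push_cast at h1 ⊢
      rw [mul_comm, pow_mul, h1, one_pow, sub_self]
    refine not_sq_dvd_geom_sum hp hodd hbp (h.trans ?_)
    have hb1 : b - 1 ≠ 0 := by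
      have : 1 < b := one_lt_pow₀ (by exact_mod_cast ha) (by simp [hm0, hp.ne_zero])
      lia
    have hlt : p ^ k * m ∈ (p ^ (k + 1) * m).properDivisors := by
      refine Nat.mem_properDivisors.2 ⟨⟨p, by ring⟩, ?_⟩
      have : 0 < p ^ k * m := Nat.mul_pos (pow_pos hp.pos k) (Nat.pos_of_ne_zero hm0)
      rw [pow_succ]
      nlinarith [hp.two_le]
    have hdvd := map_dvd (evalRingHom (a : ℤ))
      (X_pow_sub_one_mul_cyclotomic_dvd_X_pow_sub_one_of_dvd ℤ hlt)
    simp only [coe_evalRingHom, eval_mul, eval_sub, eval_pow, eval_X, eval_one, ← hb] at hdvd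
    refine (mul_dvd_mul_iff_left hb1).1 ?_
    rwa [mul_geom_sum, hb, ← pow_mul, mul_right_comm, ← pow_succ]

open Polynomial in
/-- If `a ^ n - 1` has no odd primitive prime divisor, then `Φ_n(a)` is a prime dividing `n`. -/
theorem natAbs_cyclotomic_eval_eq_prime {a n : ℕ} (ha : 2 ≤ a) (hn : 3 ≤ n)
    (h : ∀ r : ℕ, r.Prime → r ≠ 2 → orderOf (a : ZMod r) ≠ n) :
    ∃ p k m : ℕ, p.Prime ∧ n = p ^ (k + 1) * m ∧ m ∣ p - 1 ∧
      ((cyclotomic n ℤ).eval (a : ℤ)).natAbs = p := by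
  set N := ((cyclotomic n ℤ).eval (a : ℤ)).natAbs
  have hNgt : 1 < N :=
    lt_of_le_of_lt (by lia) (sub_one_lt_natAbs_cyclotomic_eval (by lia) (by lia : a ≠ 1))
  have key : ∀ p : ℕ, p.Prime → p ∣ N →
      ∃ k m : ℕ, n = p ^ (k + 1) * m ∧ ¬p ∣ m ∧ m ∣ p - 1 := by
    intro p hp hpN
    have hpN' : (p : ℤ) ∣ (cyclotomic n ℤ).eval (a : ℤ) := Int.natCast_dvd.2 hpN
    obtain ⟨k, m, hm, hnm⟩ := Nat.exists_eq_pow_mul_and_not_dvd (n := n) (by lia) p hp.ne_one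
    have hm0 : m ≠ 0 := by rintro rfl; simp at hm
    have hroot := isPrimitiveRoot_of_prime_dvd_cyclotomic_eval hp hm (hnm ▸ hpN')
    have hdvd := hroot.dvd_prime_sub_one hp hm0
    obtain _ | k := k
    · simp only [pow_zero, one_mul] at hnm
      subst hnm
      have := Nat.le_of_dvd (by have := hp.two_le; lia) hdvd
      exact (h p hp (by lia) (by simpa using hroot.eq_orderOf.symm)).elim
    · exact ⟨k, m, hnm, hm, hdvd⟩
  have hle : ∀ p q : ℕ, p.Prime → p ∣ N → q.Prime → q ∣ N → q ≤ p := by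
    intro p q hp hpN hq hqN
    obtain ⟨k, m, hnm, hm, hdvd⟩ := key p hp hpN
    obtain ⟨l, t, hnt, -, -⟩ := key q hq hqN
    have hqn : q ∣ p ^ (k + 1) * m := hnm ▸ hnt ▸ (dvd_pow_self q l.succ_ne_zero).mul_right t
    rcases hq.dvd_mul.1 hqn with h1 | h1
    · exact Nat.le_of_dvd hp.pos (hq.dvd_of_dvd_pow h1)
    · have := Nat.le_of_dvd (by have := hp.two_le; lia) (h1.trans hdvd)
      lia
  obtain ⟨p, hp, hpN⟩ := Nat.exists_prime_and_dvd hNgt.ne'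
  obtain ⟨k, m, hnm, -, hdvd⟩ := key p hp hpN
  refine ⟨p, k, m, hp, hnm, hdvd, ?_⟩
  have hNpow := Nat.eq_prime_pow_of_unique_prime_dvd (by lia : N ≠ 0)
    fun {d} hd hdN => (hle p d hp hpN hd hdN).antisymm (hle d p hd hdN hp hpN)
  have hsq : ¬p ^ 2 ∣ N := fun hsq => not_sq_dvd_cyclotomic_eval hp hn
    (hnm ▸ (dvd_pow_self p k.succ_ne_zero).mul_right m) ha (by
      have := Int.natCast_dvd.2 hsq
      push_cast at this
      exact this)
  generalize N.primeFactorsList.length = t at hNpow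
  rw [hNpow] at hsq hNgt ⊢
  obtain _ | _ | t := t
  · simp at hNgt
  · simp
  · exact (hsq (pow_dvd_pow p (by lia))).elim

theorem Nat.three_mul_succ_lt_two_pow {p : ℕ} (hp : 5 ≤ p) : 3 * (p + 1) < 2 ^ p := by
  induction p, hp using Nat.le_induction with
  | base => norm_num
  | succ p hp ih => rw [pow_succ]; lia

theorem Nat.succ_lt_two_pow {p : ℕ} (hp : 2 ≤ p) : p + 1 < 2 ^ p := by
  induction p, hp using Nat.le_induction with
  | base => norm_num
  | succ p hp ih => rw [pow_succ]; lia

open Polynomial in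
theorem lt_natAbs_cyclotomic_mul_prime_eval_two {p m : ℕ} (hp : p.Prime) (hp5 : 5 ≤ p)
    (hm0 : 0 < m) (hm : ¬p ∣ m) : p < ((cyclotomic (m * p) ℤ).eval (2 : ℤ)).natAbs := by
  have h1 := congr_arg (eval (2 : ℝ)) (cyclotomic_expand_eq_cyclotomic_mul hp hm ℝ)
  rw [expand_eval, eval_mul] at h1
  have hP : 3 * ((p : ℝ) + 1) < 2 ^ p := by exact_mod_cast Nat.three_mul_succ_lt_two_pow hp5
  have hp0 : (0 : ℝ) ≤ p := p.cast_nonneg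
  have hlow : (3 * ((p : ℝ) + 1)) ^ m.totient ≤ eval ((2 : ℝ) ^ p) (cyclotomic m ℝ) := by
    refine le_trans ?_ (sub_one_pow_totient_le_cyclotomic_eval (by linarith) m)
    refine pow_le_pow_left₀ (by positivity) ?_ _
    have h2 : ((3 * (p + 1) + 1 : ℕ) : ℝ) ≤ ((2 ^ p : ℕ) : ℝ) :=
      Nat.cast_le.2 (Nat.three_mul_succ_lt_two_pow hp5)
    push_cast at h2
    linarith
  have hup := cyclotomic_eval_le_add_one_pow_totient (one_lt_two : (1 : ℝ) < 2) m
  have hpos : 0 < eval (2 : ℝ) (cyclotomic (m * p) ℝ) := cyclotomic_pos' _ one_lt_two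
  have h3 : ((p : ℝ) + 1) ^ m.totient ≤ eval (2 : ℝ) (cyclotomic (m * p) ℝ) := by
    rw [mul_pow, h1] at hlow
    norm_num at hup
    have h3pos : (0 : ℝ) < 3 ^ m.totient := by positivity
    nlinarith
  have h4 : (p : ℝ) + 1 ≤ eval (2 : ℝ) (cyclotomic (m * p) ℝ) :=
    (le_self_pow₀ (by linarith) (Nat.totient_pos.2 hm0).ne').trans h3
  have h5 : eval (2 : ℝ) (cyclotomic (m * p) ℝ) =
      ((eval (2 : ℤ) (cyclotomic (m * p) ℤ) : ℤ) : ℝ) := by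
    rw [← map_cyclotomic_int]
    exact_mod_cast eval_intCast_map (Int.castRingHom ℝ) (cyclotomic (m * p) ℤ) 2
  rw [h5] at h4
  have h6 : (p : ℤ) + 1 ≤ eval (2 : ℤ) (cyclotomic (m * p) ℤ) := by exact_mod_cast h4
  lia

open Polynomial in
theorem lt_natAbs_cyclotomic_eval {a p k m : ℕ} (ha : 2 ≤ a) (hp : p.Prime)
    (hm : m ∣ p - 1) (hn : 3 ≤ p ^ (k + 1) * m) (hexc : ¬(a = 2 ∧ p ^ (k + 1) * m = 6)) :
    p < ((cyclotomic (p ^ (k + 1) * m) ℤ).eval (a : ℤ)).natAbs := by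
  have hm0 : 0 < m := Nat.pos_of_ne_zero (by rintro rfl; simp at hn)
  have hmp : ¬p ∣ m := fun h => by
    have := Nat.le_of_dvd (by have := hp.two_le; lia) (h.trans hm)
    have := hp.two_le
    lia
  rcases ha.eq_or_lt with rfl | ha
  · obtain _ | k := k
    · rw [zero_add, pow_one] at hn hexc ⊢
      have hp2 := hp.two_le
      rcases eq_or_ne m 1 with rfl | hm1
      · have : Fact p.Prime := ⟨hp⟩
        have h := congr_arg (eval (2 : ℤ)) (cyclotomic_prime_mul_X_sub_one ℤ p)
        simp only [eval_mul, eval_sub, eval_X, eval_one, eval_pow] at h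
        norm_num at h
        have h2 : ((p + 1 : ℕ) : ℤ) < ((2 ^ p : ℕ) : ℤ) := Nat.cast_lt.2 (Nat.succ_lt_two_pow hp2)
        push_cast at h2 ⊢
        rw [mul_one, h]
        lia
      · have hp5 : 5 ≤ p := by
          have := Nat.le_of_dvd (by lia) hm
          by_contra! hlt
          interval_cases p
          · lia
          · obtain rfl : m = 2 := by lia
            simp at hexc
          · exact absurd hp (by norm_num)
        rw [mul_comm]
        exact lt_natAbs_cyclotomic_mul_prime_eval_two hp hp5 hm0 hmp
    · have hn' : p ^ (k + 1 + 1) * m = p ^ (k + 1) * m * p := by ring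
      rw [hn', ← cyclotomic_expand_eq_cyclotomic hp (Dvd.intro (p ^ k * m) (by ring)), expand_eval]
      have h2 := Nat.succ_lt_two_pow hp.two_le
      have h1 : 1 < p ^ (k + 1) * m :=
        (Nat.one_lt_pow k.succ_ne_zero hp.one_lt).trans_le (Nat.le_mul_of_pos_right _ hm0)
      have := sub_one_lt_natAbs_cyclotomic_eval (q := 2 ^ p) h1 (by lia)
      push_cast at this ⊢
      lia
  · refine lt_of_le_of_lt ?_
      (sub_one_pow_totient_lt_natAbs_cyclotomic_eval (by lia) (by lia : a ≠ 1))
    have hle : p - 1 ≤ (p ^ (k + 1) * m).totient := by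
      rw [← Nat.totient_prime hp]
      exact Nat.le_of_dvd (Nat.totient_pos.2 (by lia))
        (Nat.totient_dvd_of_dvd (Dvd.intro (p ^ k * m) (by ring)))
    calc p ≤ 2 ^ (p - 1) := by have := Nat.lt_two_pow_self (n := p - 1); lia
      _ ≤ 2 ^ (p ^ (k + 1) * m).totient := Nat.pow_le_pow_right two_pos hle
      _ ≤ (a - 1) ^ (p ^ (k + 1) * m).totient := Nat.pow_le_pow_left (by lia) _

/-- Zsigmondy's theorem for natural number bases and exponents at least `3`. -/
theorem exists_prime_orderOf_natCast_eq {a n : ℕ} (ha : 2 ≤ a) (hn : 3 ≤ n)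
    (hexc : ¬(a = 2 ∧ n = 6)) : ∃ r : ℕ, r.Prime ∧ r ≠ 2 ∧ orderOf (a : ZMod r) = n := by
  by_contra! h
  obtain ⟨p, k, m, hp, rfl, hm, hN⟩ := natAbs_cyclotomic_eval_eq_prime ha hn h
  exact (lt_natAbs_cyclotomic_eval ha hp hm hn hexc).ne' hN

theorem orderOf_neg_of_odd {r : ℕ} (hr : r.Prime) (hr2 : r ≠ 2) {x : ZMod r}
    (hx : Odd (orderOf x)) : orderOf (-x) = 2 * orderOf x := by
  have : Fact r.Prime := ⟨hr⟩
  have h2 : orderOf (-1 : ZMod r) = 2 := by rw [orderOf_neg_one, ZMod.ringChar_zmod_n, if_neg hr2]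
  rw [← neg_one_mul, (Commute.all _ _).orderOf_mul_eq_mul_orderOf_of_coprime, h2]
  rwa [h2, Nat.coprime_two_left]

theorem orderOf_neg_of_orderOf_eq_two_mul {r n : ℕ} (hr : r.Prime) (hr2 : r ≠ 2) {x : ZMod r}
    (hn : Odd n) (hx : orderOf x = 2 * n) : orderOf (-x) = n := by
  have : Fact r.Prime := ⟨hr⟩
  have h1 : x ^ n ≠ 1 := pow_ne_one_of_lt_orderOf (by rintro rfl; simp at hn) (by grind)
  have h2 : (x ^ n) ^ 2 = 1 := by rw [← pow_mul, mul_comm, ← hx, pow_orderOf_eq_one]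
  have h3 : (-x) ^ n = 1 := by
    rw [hn.neg_pow, (sq_eq_one_iff.1 h2).resolve_left h1, neg_neg]
  have h4 := orderOf_neg_of_odd hr hr2 (hn.of_dvd_nat (orderOf_dvd_of_pow_eq_one h3))
  rw [neg_neg] at h4
  lia

theorem orderOf_neg_of_four_dvd {r : ℕ} (hr : r.Prime) (hr2 : r ≠ 2) {x : ZMod r}
    (hx : 4 ∣ orderOf x) : orderOf (-x) = orderOf x := by
  have heven : ∀ {k : ℕ}, Even k → ((-x) ^ k = 1 ↔ x ^ k = 1) := fun hk => by rw [hk.neg_pow]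
  refine Nat.dvd_antisymm
    (orderOf_dvd_of_pow_eq_one ((heven (by grind)).2 (pow_orderOf_eq_one x))) ?_
  rcases Nat.even_or_odd (orderOf (-x)) with h | h
  · exact orderOf_dvd_of_pow_eq_one ((heven h).1 (pow_orderOf_eq_one (-x)))
  · have := orderOf_neg_of_odd hr hr2 h
    rw [neg_neg] at this
    grind

theorem exists_prime_orderOf_intCast_eq {a : ℤ} (ha : 1 < |a|) {n : ℕ} (hn : 3 ≤ n)
    (h2 : ¬(a = 2 ∧ n = 6)) (h3 : ¬(a = -2 ∧ n = 3)) :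
    ∃ r : ℕ, r.Prime ∧ r ≠ 2 ∧ orderOf (a : ZMod r) = n := by
  obtain ⟨b, hab⟩ := Int.eq_nat_or_neg a
  have hb : 2 ≤ b := by rcases hab with rfl | rfl <;> simpa [Nat.succ_le_iff] using ha
  rcases hab with rfl | rfl
  · simp only [Int.cast_natCast]
    exact exists_prime_orderOf_natCast_eq hb hn (by lia)
  simp only [Int.cast_neg, Int.cast_natCast]
  rcases Nat.even_or_odd' n with ⟨j, rfl | hj⟩
  · rcases Nat.even_or_odd j with hj | hj
    · obtain ⟨r, hr, hr2, h⟩ := exists_prime_orderOf_natCast_eq hb hn (by grind)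
      exact ⟨r, hr, hr2, by rw [orderOf_neg_of_four_dvd hr hr2 (by grind), h]⟩
    · obtain ⟨r, hr, hr2, h⟩ := exists_prime_orderOf_natCast_eq hb (n := j) (by grind) (by grind)
      exact ⟨r, hr, hr2, by rw [orderOf_neg_of_odd hr hr2 (h ▸ hj), h]⟩
  · obtain ⟨r, hr, hr2, h⟩ :=
      exists_prime_orderOf_natCast_eq hb (n := 2 * n) (by lia) (by lia)
    exact ⟨r, hr, hr2, orderOf_neg_of_orderOf_eq_two_mul hr hr2 ⟨j, hj⟩ h⟩

theorem four_dvd_or_exists_odd_prime_dvd {x : ℤ} (hx : 2 < |x|) :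
    4 ∣ x ∨ ∃ r : ℕ, r.Prime ∧ r ≠ 2 ∧ (r : ℤ) ∣ x := by
  rw [Int.abs_eq_natAbs] at hx
  rcases Nat.four_dvd_or_exists_odd_prime_and_dvd_of_two_lt (n := x.natAbs) (by lia) with
    h | ⟨r, hr, h, hodd⟩
  · exact Or.inl (by lia)
  · exact Or.inr ⟨r, hr, by rintro rfl; exact absurd hodd (by decide), Int.natCast_dvd.2 h⟩

/-- Bang–Zsigmondy: if `|a| > 1` and `i ≥ 1` with
`(a,i) ∉ {(2,1),(2,6),(-2,2),(-2,3),(3,1),(-3,2)}`, then `a^i - 1` has a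
primitive prime divisor, i.e. a prime `r` with `e r a = i`. -/
theorem bang_zsigmondy
    (a : ℤ) (ha : 1 < |a|) (i : ℕ) (hi : 0 < i)
    (hexc : (a, i) ∉ ({(2, 1), (2, 6), (-2, 2), (-2, 3), (3, 1), (-3, 2)} :
      Set (ℤ × ℕ))) :
    ∃ r : ℕ, r.Prime ∧ e r a = i := by
  simp only [Set.mem_insert_iff, Set.mem_singleton_iff, Prod.mk.injEq, not_or] at hexc
  obtain rfl | rfl | hi3 : i = 1 ∨ i = 2 ∨ 3 ≤ i := by lia
  · rcases four_dvd_or_exists_odd_prime_dvd (x := a - 1) (by grind) with h | ⟨r, hr, hr2, h⟩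
    · exact ⟨2, Nat.prime_two, by simp [e, h]⟩
    · refine ⟨r, hr, ?_⟩
      rw [← ZMod.intCast_zmod_eq_zero_iff_dvd, Int.cast_sub, Int.cast_one, sub_eq_zero] at h
      rw [e, if_neg hr2, h, orderOf_one]
  · rcases four_dvd_or_exists_odd_prime_dvd (x := a + 1) (by grind) with h | ⟨r, hr, hr2, h⟩
    · exact ⟨2, Nat.prime_two, by rw [e, if_pos rfl, if_neg (by lia), if_pos h]⟩
    · refine ⟨r, hr, ?_⟩
      have : Fact r.Prime := ⟨hr⟩
      rw [← ZMod.intCast_zmod_eq_zero_iff_dvd, Int.cast_add, Int.cast_one,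
        add_eq_zero_iff_eq_neg] at h
      rw [e, if_neg hr2, h, orderOf_neg_one, ZMod.ringChar_zmod_n, if_neg hr2]
  · obtain ⟨r, hr, hr2, h⟩ := exists_prime_orderOf_intCast_eq ha hi3 (by lia) (by lia)
    exact ⟨r, hr, by rw [e, if_neg hr2, h]⟩
end

section
/- Let q be a prime power, n ≥ 9 an integer, and L = PSL_n(q). Let s1 and s2 be primes such that the multiplicative order of q modulo s1 equals n and the multiplicative order of q modulo s2 equals n−1. Then: (i) s1·s2 ∉ ω(L) and there is no prime r with both r·s1 ∈ ω(L) and r·s2 ∈ ω(L); (ii) the number m1 = (q^n−1)/((q−1)·gcd(n,q−1)) lies in ω(L) and every element of ω(L) divisible by s1 divides m1; likewise m2 = (q^{n−1}−1)/gcd(n,q−1) lies in ω(L) and every element of ω(L) divisible by s2 divides m2. -/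
/-- The spectrum of a group `G`: the set of element orders of `G`. -/
def elementOrders (G : Type*) [Monoid G] : Set ℕ := {n | ∃ g : G, orderOf g = n}

/-- `PSL n F`: the projective special linear group over `F`,
i.e. the quotient of `SL_n(F)` by its center. -/
abbrev PSL (n : ℕ) (F : Type*) [Field F] :=
  Matrix.SpecialLinearGroup (Fin n) F ⧸
    Subgroup.center (Matrix.SpecialLinearGroup (Fin n) F)

/-- `PSp n F`: the projective symplectic group, i.e. the quotient of the
symplectic group `Sp_{2n}(F)` (2n×2n matrices preserving the standard symplectic
form) by its center. -/
abbrev PSp (n : ℕ) (F : Type*) [Field F] :=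
  Matrix.symplecticGroup (Fin n) F ⧸
    Subgroup.center (Matrix.symplecticGroup (Fin n) F)

/-- `G` is an almost simple group with socle isomorphic to `L`: there is an
injective homomorphism `ι : G → Aut L` whose image contains the inner
automorphisms `Inn L`. -/
def IsAlmostSimpleWithSocle (G : Type*) [Group G] (L : Type*) [Group L] : Prop :=
  ∃ ι : G →* MulAut L, Function.Injective ι ∧ (MulAut.conj (G := L)).range ≤ ι.range

section

open Polynomial Finset

section Arithmetic

theorem Nat.dvd_mul_iff_div_gcd_dvd {a b : ℕ} (hb : b ≠ 0) (j : ℕ) :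
    a ∣ j * b ↔ a / a.gcd b ∣ j := by
  have hd : 0 < a.gcd b := Nat.gcd_pos_of_pos_right _ (Nat.pos_of_ne_zero hb)
  have ha : a / a.gcd b * a.gcd b = a := Nat.div_mul_cancel (Nat.gcd_dvd_left a b)
  have hb' : b / a.gcd b * a.gcd b = b := Nat.div_mul_cancel (Nat.gcd_dvd_right a b)
  have hc : (a / a.gcd b).Coprime (b / a.gcd b) := Nat.coprime_div_gcd_div_gcd hd
  calc a ∣ j * b ↔ a / a.gcd b * a.gcd b ∣ j * (b / a.gcd b) * a.gcd b := by
        rw [ha, mul_assoc, hb']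
    _ ↔ a / a.gcd b ∣ j * (b / a.gcd b) := Nat.mul_dvd_mul_iff_right hd
    _ ↔ _ := hc.dvd_mul_right

variable {q : ℕ}

theorem Nat.geomSum_modEq (hq : 1 ≤ q) (k : ℕ) :
    ∑ i ∈ range k, q ^ i ≡ k [MOD (q - 1)] := by
  have h : q ≡ 1 [MOD (q - 1)] := ((Nat.modEq_iff_dvd' hq).2 dvd_rfl).symm
  induction k with
  | zero => rfl
  | succ k ih =>
    rw [Finset.sum_range_succ]
    simpa using ih.add (h.pow k)

theorem Nat.gcd_geomSum (hq : 1 ≤ q) (k : ℕ) :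
    (∑ i ∈ range k, q ^ i).gcd (q - 1) = k.gcd (q - 1) :=
  (Nat.geomSum_modEq hq k).gcd_eq

theorem Nat.gcd_pow_sub_one_geomSum_add_one (hq : 1 ≤ q) (k : ℕ) :
    (q ^ k - 1).gcd (∑ i ∈ range k, q ^ i + 1) = (k + 1).gcd (q - 1) := by
  rw [← geom_sum_mul_of_one_le hq]
  have hc : (∑ i ∈ range k, q ^ i).Coprime (∑ i ∈ range k, q ^ i + 1) := by simp
  rw [hc.gcd_mul_left_cancel, Nat.gcd_comm]
  exact ((Nat.geomSum_modEq hq k).add_right 1).gcd_eq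

theorem Nat.pow_sub_one_div_mul_eq (hq : 2 ≤ q) (k d : ℕ) :
    (q ^ k - 1) / ((q - 1) * d) = (∑ i ∈ range k, q ^ i) / d := by
  rw [← geom_sum_mul_of_one_le (by lia), ← Nat.div_div_eq_div_mul,
    Nat.mul_div_cancel _ (by lia)]

theorem Nat.coprime_geomSum_div (hq : 2 ≤ q) (k : ℕ) :
    ((∑ i ∈ range (k + 1), q ^ i) / (k + 1).gcd (q - 1)).Coprime
      ((q ^ k - 1) / (k + 1).gcd (q - 1)) := by
  have hd : 0 < (k + 1).gcd (q - 1) := Nat.gcd_pos_of_pos_left _ k.succ_pos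
  rw [← geom_sum_mul_of_one_le (by lia),
    Nat.mul_div_assoc _ (Nat.gcd_dvd_right (k + 1) (q - 1))]
  refine Nat.Coprime.mul_right ?_ ?_
  · have h : (∑ i ∈ range (k + 1), q ^ i).Coprime (∑ i ∈ range k, q ^ i) := by
      rw [geom_sum_succ]
      simp
    refine h.coprime_dvd_left (Nat.div_dvd_of_dvd ?_)
    rw [← Nat.gcd_geomSum (by lia)]
    exact Nat.gcd_dvd_left _ _
  · rw [← Nat.gcd_geomSum (by lia)] at hd ⊢
    exact Nat.coprime_div_gcd_div_gcd hd

end Arithmetic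

section FiniteField

variable {F K : Type*} [Field F] [Field K] [Algebra F K] [Finite F] [Finite K]

theorem FiniteField.mem_range_algebraMap_iff_pow_card {x : K} :
    x ∈ Set.range (algebraMap F K) ↔ x ^ Nat.card F = x := by
  have := Fintype.ofFinite F
  constructor
  · rintro ⟨a, rfl⟩
    rw [← map_pow, Nat.card_eq_fintype_card, FiniteField.pow_card]
  · intro h
    rw [IsGalois.mem_range_algebraMap_iff_fixed]
    intro g
    obtain ⟨p, hp, -⟩ := FiniteField.card' F
    have : Fact p.Prime := ⟨CharP.char_is_prime F p⟩
    obtain ⟨i, hi⟩ := FiniteField.exists_forall_apply_eq_pow F p K g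
    rw [hi]
    have : (fun y : K ↦ y ^ Nat.card F)^[i] x = x := Function.iterate_fixed h i
    rwa [pow_iterate] at this

theorem FiniteField.mem_range_algebraMap_iff_pow_card_sub_one {x : K} (hx : x ≠ 0) :
    x ∈ Set.range (algebraMap F K) ↔ x ^ (Nat.card F - 1) = 1 := by
  rw [mem_range_algebraMap_iff_pow_card]
  have h : Nat.card F = Nat.card F - 1 + 1 := by have := Nat.card_pos (α := F); lia
  nth_rw 1 [h]
  rw [pow_succ, mul_eq_right₀ hx]

theorem FiniteField.exists_orderOf_eq_card_sub_one (K : Type*) [Field K] [Finite K] :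
    ∃ x : K, x ≠ 0 ∧ orderOf x = Nat.card K - 1 := by
  obtain ⟨g, hg⟩ := IsCyclic.exists_generator (α := Kˣ)
  refine ⟨g, g.ne_zero, ?_⟩
  rw [orderOf_units, orderOf_eq_card_of_forall_mem_zpowers hg, Nat.card_units]

end FiniteField

section Existence

variable {F : Type} [Field F]

theorem mk_pow_eq_one_iff {n : ℕ} (g : Matrix.SpecialLinearGroup (Fin n) F) (j : ℕ) :
    (QuotientGroup.mk g : PSL n F) ^ j = 1 ↔
      (g : Matrix (Fin n) (Fin n) F) ^ j ∈ Set.range (algebraMap F (Matrix (Fin n) (Fin n) F)) := by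
  rw [← QuotientGroup.mk_pow, QuotientGroup.eq_one_iff,
    Matrix.SpecialLinearGroup.mem_center_iff]
  constructor
  · rintro ⟨r, -, hr⟩
    refine ⟨r, ?_⟩
    rw [← Matrix.SpecialLinearGroup.coe_pow, ← hr]
    rfl
  · rintro ⟨r, hr⟩
    rw [← Matrix.SpecialLinearGroup.coe_pow] at hr
    refine ⟨r, ?_, hr⟩
    rw [← (g ^ j).det_coe, ← hr, Matrix.algebraMap_eq_diagonal]
    simp

theorem mem_elementOrders_of_norm_eq_one {n : ℕ} {A : Type*} [CommRing A] [Algebra F A]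
    [Module.Finite F A] (hA : Module.finrank F A = n) {x : A} (hx : Algebra.norm F x = 1) {k : ℕ}
    (hk : ∀ j, x ^ j ∈ Set.range (algebraMap F A) ↔ k ∣ j) : k ∈ elementOrders (PSL n F) := by
  let b := Module.finBasisOfFinrankEq F A hA
  let g : Matrix.SpecialLinearGroup (Fin n) F :=
    ⟨Algebra.leftMulMatrix b x, by rw [← Algebra.norm_eq_matrix_det, hx]⟩
  refine ⟨(QuotientGroup.mk g : PSL n F), Nat.dvd_right_iff_eq.1 fun j ↦ ?_⟩
  rw [orderOf_dvd_iff_pow_eq_one, mk_pow_eq_one_iff, ← hk]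
  simp only [g, ← map_pow, Set.mem_range]
  refine exists_congr fun a ↦ ?_
  rw [← AlgHom.commutes (Algebra.leftMulMatrix b), (Algebra.leftMulMatrix_injective b).eq_iff]

variable [Finite F]

variable (F) in
theorem exists_finite_extension (n : ℕ) (hn : n ≠ 0) :
    ∃ (K : Type) (_ : Field K) (_ : Algebra F K), Finite K ∧ Module.finrank F K = n := by
  have := Fintype.ofFinite F
  obtain ⟨p, hp, -⟩ := FiniteField.card' F
  have : Fact p.Prime := ⟨CharP.char_is_prime F p⟩
  have : NeZero n := ⟨hn⟩
  exact ⟨FiniteField.Extension F p n, inferInstance, inferInstance, inferInstance,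
    FiniteField.finrank_extension F p n⟩

theorem geomSum_div_gcd_mem_elementOrders {n : ℕ} (hn : n ≠ 0) :
    (∑ i ∈ range n, Nat.card F ^ i) / n.gcd (Nat.card F - 1) ∈ elementOrders (PSL n F) := by
  obtain ⟨K, _, _, _, hK⟩ := exists_finite_extension F n hn
  obtain ⟨y, hy0, hy⟩ := FiniteField.exists_orderOf_eq_card_sub_one K
  have hq : 2 ≤ Nat.card F := Finite.one_lt_card
  have : Module.Finite F K := .of_finite
  rw [Module.natCard_eq_pow_finrank (K := F), hK, ← geom_sum_mul_of_one_le (by lia)] at hy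
  refine mem_elementOrders_of_norm_eq_one hK (x := y ^ (Nat.card F - 1)) ?_ fun j ↦ ?_
  · apply (algebraMap F K).injective
    rw [FiniteField.algebraMap_norm_eq_pow_sum, hK, map_one, ← pow_mul, mul_comm, ← hy,
      pow_orderOf_eq_one]
  · rw [FiniteField.mem_range_algebraMap_iff_pow_card_sub_one (by simp [hy0]), ← pow_mul,
      ← pow_mul, ← orderOf_dvd_iff_pow_eq_one, hy, mul_comm (_ - 1), mul_assoc,
      mul_comm (_ - 1), ← mul_assoc,
      Nat.mul_dvd_mul_iff_right (by lia), Nat.dvd_mul_iff_div_gcd_dvd (by lia),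
      Nat.gcd_geomSum (by lia)]

theorem pow_sub_one_div_gcd_mem_elementOrders {k : ℕ} (hk : k ≠ 0) :
    (Nat.card F ^ k - 1) / (k + 1).gcd (Nat.card F - 1) ∈ elementOrders (PSL (k + 1) F) := by
  obtain ⟨K, _, _, _, hK⟩ := exists_finite_extension F k hk
  obtain ⟨y, hy0, hy⟩ := FiniteField.exists_orderOf_eq_card_sub_one K
  have hq : 2 ≤ Nat.card F := Finite.one_lt_card
  have : Module.Finite F K := .of_finite
  rw [Module.natCard_eq_pow_finrank (K := F), hK] at hy
  have hN : Algebra.norm F y ≠ 0 := Algebra.norm_ne_zero_iff.2 hy0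
  refine mem_elementOrders_of_norm_eq_one (A := K × F) (x := (y, (Algebra.norm F y)⁻¹))
    (by simp [hK]) ?_ fun j ↦ ?_
  · have h : Algebra.lmul F (K × F) (y, (Algebra.norm F y)⁻¹) =
        (Algebra.lmul F K y).prodMap (Algebra.lmul F F (Algebra.norm F y)⁻¹) := by
      ext <;> simp
    rw [Algebra.norm_apply, h, LinearMap.det_prodMap, ← Algebra.norm_apply, ← Algebra.norm_apply,
      Algebra.norm_self]
    simp [hN]
  · have h : (y, (Algebra.norm F y)⁻¹) ^ j ∈ Set.range (algebraMap F (K × F)) ↔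
        algebraMap F K ((Algebra.norm F y)⁻¹ ^ j) = y ^ j := by
      simp [Prod.ext_iff]
    rw [h, map_pow, map_inv₀, inv_pow, FiniteField.algebraMap_norm_eq_pow_sum, hK, ← pow_mul,
      ← div_eq_one_iff_eq (by simp [hy0]), div_eq_mul_inv, ← mul_inv, inv_eq_one,
      ← pow_add,
      ← orderOf_dvd_iff_pow_eq_one, hy, ← Nat.gcd_pow_sub_one_geomSum_add_one (by lia),
      ← Nat.dvd_mul_iff_div_gcd_dvd (by lia)]
    ring_nf

end Existence

section UpperBound

variable {F : Type} [Field F]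

theorem orderOf_mk_dvd_of_charpoly_dvd {n m : ℕ} {g : Matrix.SpecialLinearGroup (Fin n) F} {a : F}
    (h : g.1.charpoly ∣ X ^ m - C a) : orderOf (QuotientGroup.mk g : PSL n F) ∣ m := by
  rw [orderOf_dvd_iff_pow_eq_one, mk_pow_eq_one_iff]
  have h' := Polynomial.aeval_eq_zero_of_dvd_aeval_eq_zero h (Matrix.aeval_self_charpoly g.1)
  refine ⟨a, Eq.symm ?_⟩
  simpa [sub_eq_zero] using h'

theorem AdjoinRoot.natCard_eq_pow_natDegree {f : F[X]} (hf : f.Monic) :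
    Nat.card (AdjoinRoot f) = Nat.card F ^ f.natDegree := by
  have : Module.Finite F (AdjoinRoot f) := hf.finite_adjoinRoot
  rw [Module.natCard_eq_pow_finrank (K := F), (AdjoinRoot.powerBasis hf.ne_zero).finrank,
    AdjoinRoot.powerBasis_dim]

variable [Finite F]

theorem AdjoinRoot.root_pow_geomSum {f : F[X]} (hf : f.Monic) [Fact (Irreducible f)] :
    AdjoinRoot.root f ^ (∑ i ∈ range f.natDegree, Nat.card F ^ i) =
      algebraMap F (AdjoinRoot f) ((-1) ^ f.natDegree * f.coeff 0) := by
  let pb := AdjoinRoot.powerBasis hf.ne_zero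
  have : Module.Finite F (AdjoinRoot f) := pb.finite
  have : Finite (AdjoinRoot f) := Module.finite_of_finite F
  have h := FiniteField.algebraMap_norm_eq_pow_sum F (AdjoinRoot f) pb.gen
  rw [Algebra.PowerBasis.norm_gen_eq_coeff_zero_minpoly,
    AdjoinRoot.minpoly_powerBasis_gen_of_monic hf, pb.finrank] at h
  exact h.symm

theorem exists_irreducible_dvd_charpoly {n s : ℕ} (hs : s.Prime) (hsF : (s : F) ≠ 0)
    (g : Matrix.SpecialLinearGroup (Fin n) F)
    (hg : s ∣ orderOf (QuotientGroup.mk g : PSL n F)) :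
    ∃ f : F[X], f.Monic ∧ Irreducible f ∧ f ∣ g.1.charpoly ∧
      orderOf (Nat.card F : ZMod s) ∣ f.natDegree := by
  have : Fact s.Prime := ⟨hs⟩
  have hsg : s ∣ orderOf g := hg.trans (orderOf_map_dvd (QuotientGroup.mk' _) g)
  obtain ⟨j, hj⟩ := hsg
  have hj0 : j ≠ 0 := by
    rintro rfl
    exact (orderOf_pos g).ne' (by simpa using hj)
  have hgs : g.1 ^ (j * s) = 1 := by
    rw [← Matrix.SpecialLinearGroup.coe_pow, mul_comm, ← hj, pow_orderOf_eq_one,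
      Matrix.SpecialLinearGroup.coe_one]
  have hgj : g.1 ^ j ≠ 1 := by
    intro h
    have h' : g ^ j = 1 := by
      ext1
      simpa using congrFun (congrFun h _) _
    have := Nat.le_of_dvd (Nat.pos_of_ne_zero hj0) (orderOf_dvd_of_pow_eq_one h')
    have := hs.two_le
    nlinarith [Nat.pos_of_ne_zero hj0]
  have hdvd : minpoly F g.1 ∣ (∑ i ∈ range s, (X ^ j : F[X]) ^ i) * (X ^ j - 1) := by
    refine minpoly.dvd _ _ ?_
    rw [geom_sum_mul, ← pow_mul]
    simp [hgs]
  obtain ⟨z, hz, hzg, hzQ⟩ : ∃ z : F[X], Irreducible z ∧ z ∣ minpoly F g.1 ∧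
      z ∣ ∑ i ∈ range s, (X ^ j : F[X]) ^ i := by
    by_contra! H
    have hco := isCoprime_of_irreducible_dvd
      (fun h ↦ minpoly.ne_zero (Matrix.isIntegral g.1) h.1) H
    have h := Polynomial.aeval_eq_zero_of_dvd_aeval_eq_zero (hco.dvd_of_dvd_mul_left hdvd)
      (minpoly.aeval F g.1)
    exact hgj (by simpa [sub_eq_zero] using h)
  obtain ⟨f, hmon, hfz⟩ : ∃ f : F[X], f.Monic ∧ Associated f z :=
    ⟨_, monic_mul_leadingCoeff_inv hz.ne_zero,
      associated_mul_unit_left _ _ (isUnit_C.2 (by simpa using hz.ne_zero))⟩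
  have hf : Irreducible f := hfz.symm.irreducible hz
  have : Fact (Irreducible f) := ⟨hf⟩
  refine ⟨f, hmon, hf, (hfz.dvd.trans hzg).trans (Matrix.minpoly_dvd_charpoly g.1), ?_⟩
  let c := AdjoinRoot.root f
  have hfin : Module.Finite F (AdjoinRoot f) := hmon.finite_adjoinRoot
  have : Finite (AdjoinRoot f) := Module.finite_of_finite F
  have hc : ∑ i ∈ range s, (c ^ j) ^ i = 0 := by
    have h := AdjoinRoot.mk_eq_zero.2 (hfz.dvd.trans hzQ)
    simpa using h
  have hcs : (c ^ j) ^ s = 1 := by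
    have h := geom_sum_mul (c ^ j) s
    rwa [hc, zero_mul, eq_comm, sub_eq_zero] at h
  have hc1 : c ^ j ≠ 1 := by
    intro h
    simp only [h, one_pow, sum_const, card_range, nsmul_eq_mul, mul_one] at hc
    exact hsF ((algebraMap F (AdjoinRoot f)).injective (by simpa using hc))
  have hc0 : c ^ j ≠ 0 := by
    intro h
    simp [h, hs.ne_zero] at hcs
  have hord : s ∣ Nat.card (AdjoinRoot f) - 1 := by
    have := Fintype.ofFinite (AdjoinRoot f)
    rw [← orderOf_eq_prime hcs hc1, Nat.card_eq_fintype_card]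
    exact orderOf_dvd_of_pow_eq_one (FiniteField.pow_card_sub_one_eq_one _ hc0)
  rw [AdjoinRoot.natCard_eq_pow_natDegree hmon, ← ZMod.natCast_eq_zero_iff,
    Nat.cast_sub (Nat.pow_pos Nat.card_pos), sub_eq_zero] at hord
  exact orderOf_dvd_of_pow_eq_one (by simpa using hord)

theorem natCast_ne_zero_of_orderOf_ne_zero {s : ℕ} (hs : s.Prime)
    (h : orderOf (Nat.card F : ZMod s) ≠ 0) : (s : F) ≠ 0 := by
  have := Fintype.ofFinite F
  intro h0
  obtain ⟨p, hp, k, hpp, hk⟩ := FiniteField.card' F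
  have hps : p = s := (Nat.prime_dvd_prime_iff_eq hpp hs).1 ((CharP.cast_eq_zero_iff F p s).1 h0)
  have : Fact s.Prime := ⟨hs⟩
  rw [Nat.card_eq_fintype_card, hk, hps] at h
  simp at h

theorem orderOf_mk_dvd_geomSum_div {n s : ℕ} (hn : n ≠ 0) (hs : s.Prime)
    (ho : orderOf (Nat.card F : ZMod s) = n) (g : Matrix.SpecialLinearGroup (Fin n) F)
    (hg : s ∣ orderOf (QuotientGroup.mk g : PSL n F)) :
    orderOf (QuotientGroup.mk g : PSL n F) ∣
      (∑ i ∈ range n, Nat.card F ^ i) / n.gcd (Nat.card F - 1) := by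
  obtain ⟨f, hmon, hf, hfg, hdeg⟩ := exists_irreducible_dvd_charpoly hs
    (natCast_ne_zero_of_orderOf_ne_zero hs (by lia)) g hg
  have : Fact (Irreducible f) := ⟨hf⟩
  have hfin : Module.Finite F (AdjoinRoot f) := hmon.finite_adjoinRoot
  have : Finite (AdjoinRoot f) := Module.finite_of_finite F
  rw [ho] at hdeg
  have hfg' : g.1.charpoly = f := by
    refine Polynomial.eq_of_monic_of_dvd_of_natDegree_le hmon (Matrix.charpoly_monic _) hfg ?_
    simpa using Nat.le_of_dvd hf.natDegree_pos hdeg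
  have hn' : f.natDegree = n := by simp [← hfg']
  have hroot := AdjoinRoot.root_pow_geomSum hmon
  have hdet := Matrix.det_eq_sign_charpoly_coeff g.1
  rw [g.2, Fintype.card_fin, hfg'] at hdet
  rw [hn', ← hdet, map_one] at hroot
  have hq : 2 ≤ Nat.card F := Finite.one_lt_card
  have hc0 : AdjoinRoot.root f ≠ 0 := by
    intro h
    rw [h, zero_pow (Nat.pos_of_ne_zero ?_).ne'] at hroot
    · simp at hroot
    · exact (Finset.sum_pos (fun i _ ↦ by positivity) (by simpa using hn)).ne'
  set m := (∑ i ∈ range n, Nat.card F ^ i) / n.gcd (Nat.card F - 1)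
  obtain ⟨a, ha⟩ : AdjoinRoot.root f ^ m ∈ Set.range (algebraMap F (AdjoinRoot f)) := by
    rw [FiniteField.mem_range_algebraMap_iff_pow_card_sub_one (pow_ne_zero _ hc0), ← pow_mul]
    have h : ∑ i ∈ range n, Nat.card F ^ i ∣ m * (Nat.card F - 1) := by
      rw [Nat.dvd_mul_iff_div_gcd_dvd (by lia), Nat.gcd_geomSum (by lia)]
    obtain ⟨t, ht⟩ := h
    rw [ht, pow_mul, hroot, one_pow]
  refine orderOf_mk_dvd_of_charpoly_dvd (a := a) ?_
  rw [hfg', ← AdjoinRoot.mk_eq_zero]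
  simpa [sub_eq_zero] using ha.symm

theorem orderOf_mk_dvd_pow_sub_one_div {k s : ℕ} (hk : 2 ≤ k) (hs : s.Prime)
    (ho : orderOf (Nat.card F : ZMod s) = k) (g : Matrix.SpecialLinearGroup (Fin (k + 1)) F)
    (hg : s ∣ orderOf (QuotientGroup.mk g : PSL (k + 1) F)) :
    orderOf (QuotientGroup.mk g : PSL (k + 1) F) ∣
      (Nat.card F ^ k - 1) / (k + 1).gcd (Nat.card F - 1) := by
  obtain ⟨f, hmon, hf, ⟨h, hfh⟩, hdeg⟩ := exists_irreducible_dvd_charpoly hs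
    (natCast_ne_zero_of_orderOf_ne_zero hs (by lia)) g hg
  have : Fact (Irreducible f) := ⟨hf⟩
  have hfin : Module.Finite F (AdjoinRoot f) := hmon.finite_adjoinRoot
  have : Finite (AdjoinRoot f) := Module.finite_of_finite F
  rw [ho] at hdeg
  have hh : h.Monic := hmon.of_mul_monic_left (hfh ▸ Matrix.charpoly_monic _)
  have hsum : f.natDegree + h.natDegree = k + 1 := by
    rw [← hmon.natDegree_mul hh, ← hfh]
    simp
  have hfk : f.natDegree = k := by
    obtain ⟨t, ht⟩ := hdeg
    have := hf.natDegree_pos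
    obtain rfl : t = 1 := by
      have : t ≠ 0 := by rintro rfl; lia
      by_contra h1
      have : 2 ≤ t := by lia
      nlinarith
    lia
  obtain ⟨b, rfl⟩ : ∃ b, h = X - C b := by
    refine ⟨-h.coeff 0, ?_⟩
    rw [hh.eq_X_add_C (by lia)]
    simp
  have hq : 2 ≤ Nat.card F := Finite.one_lt_card
  set c := AdjoinRoot.root f
  have hroot : c ^ (∑ i ∈ range k, Nat.card F ^ i) * algebraMap F (AdjoinRoot f) b = 1 := by
    have hdet := Matrix.det_eq_sign_charpoly_coeff g.1
    rw [g.2, Fintype.card_fin, hfh, mul_coeff_zero, pow_succ] at hdet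
    have := AdjoinRoot.root_pow_geomSum hmon
    rw [hfk] at this
    rw [this, ← map_mul, ← map_one (algebraMap F (AdjoinRoot f))]
    congr 1
    simpa [mul_assoc] using hdet.symm
  have hc0 : c ≠ 0 := by
    intro h
    rw [h, zero_pow, zero_mul] at hroot
    · simp at hroot
    · exact (Finset.sum_pos (fun i _ ↦ by positivity) (by simp; lia)).ne'
  have hcard : c ^ (Nat.card F ^ k - 1) = 1 := by
    have := Fintype.ofFinite (AdjoinRoot f)
    rw [← hfk, ← AdjoinRoot.natCard_eq_pow_natDegree hmon, Nat.card_eq_fintype_card]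
    exact FiniteField.pow_card_sub_one_eq_one _ hc0
  set m := (Nat.card F ^ k - 1) / (k + 1).gcd (Nat.card F - 1)
  have hcb : c ^ m = algebraMap F (AdjoinRoot f) (b ^ m) := by
    have h : Nat.card F ^ k - 1 ∣ m * (∑ i ∈ range k, Nat.card F ^ i + 1) := by
      rw [Nat.dvd_mul_iff_div_gcd_dvd (by lia), Nat.gcd_pow_sub_one_geomSum_add_one (by lia)]
    obtain ⟨t, ht⟩ := h
    have h1 : c ^ m * (c ^ (∑ i ∈ range k, Nat.card F ^ i)) ^ m = 1 := by
      rw [← pow_mul, ← pow_add, add_comm, mul_comm _ m, ← Nat.mul_succ, ht, pow_mul, hcard,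
        one_pow]
    have h2 := congrArg (· ^ m) hroot
    simp only [mul_pow, one_pow] at h2
    rw [map_pow]
    exact left_inv_eq_right_inv h1 h2
  refine orderOf_mk_dvd_of_charpoly_dvd (a := b ^ m) ?_
  rw [hfh]
  refine IsCoprime.mul_dvd ?_ ?_ ?_
  · rw [hf.coprime_iff_not_dvd]
    intro hd
    have := natDegree_le_of_dvd hd (X_sub_C_ne_zero b)
    rw [natDegree_X_sub_C] at this
    lia
  · rw [← AdjoinRoot.mk_eq_zero]
    simpa [sub_eq_zero] using hcb
  · rw [dvd_iff_isRoot]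
    simp

end UpperBound

end

/-- For `L = PSL_n(q)`, `n ≥ 9`, and primes `s₁, s₂` with `ord_{s₁}(q) = n` and
`ord_{s₂}(q) = n - 1`: the neighborhoods of `s₁` and `s₂` in the prime graph of
`L` are disjoint, and the elements of `ω(L)` divisible by `sᵢ` are exactly the
divisors of `mᵢ` that are so divisible, where `m₁ = (qⁿ-1)/((q-1)(n,q-1))` and
`m₂ = (q^{n-1}-1)/(n,q-1)`. -/
theorem psl_disjoint_neighborhoods
    (q : ℕ) (hq : IsPrimePow q) (n : ℕ) (hn : 9 ≤ n)
    (F : Type) [Field F] [Fintype F] (hF : Fintype.card F = q)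
    (s1 s2 : ℕ) (hs1 : s1.Prime) (hs2 : s2.Prime)
    (ho1 : orderOf ((q : ZMod s1)) = n) (ho2 : orderOf ((q : ZMod s2)) = n - 1) :
    (s1 * s2 ∉ elementOrders (PSL n F) ∧
      ¬ ∃ r : ℕ, r.Prime ∧ r * s1 ∈ elementOrders (PSL n F) ∧
        r * s2 ∈ elementOrders (PSL n F)) ∧
    ((q ^ n - 1) / ((q - 1) * Nat.gcd n (q - 1)) ∈ elementOrders (PSL n F) ∧
      ∀ a ∈ elementOrders (PSL n F), s1 ∣ a →
        a ∣ (q ^ n - 1) / ((q - 1) * Nat.gcd n (q - 1))) ∧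
    ((q ^ (n - 1) - 1) / Nat.gcd n (q - 1) ∈ elementOrders (PSL n F) ∧
      ∀ a ∈ elementOrders (PSL n F), s2 ∣ a →
        a ∣ (q ^ (n - 1) - 1) / Nat.gcd n (q - 1)) := by
  rw [← Nat.card_eq_fintype_card] at hF
  subst hF
  obtain ⟨k, rfl⟩ : ∃ k, n = k + 1 := ⟨n - 1, by lia⟩
  have hq2 : 2 ≤ Nat.card F := Finite.one_lt_card
  simp only [Nat.add_sub_cancel] at ho2 ⊢
  rw [Nat.pow_sub_one_div_mul_eq hq2]
  have h1 : ∀ a ∈ elementOrders (PSL (k + 1) F), s1 ∣ a →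
      a ∣ (∑ i ∈ Finset.range (k + 1), Nat.card F ^ i) / (k + 1).gcd (Nat.card F - 1) := by
    rintro _ ⟨x, rfl⟩ ha
    obtain ⟨g, rfl⟩ := QuotientGroup.mk_surjective x
    exact orderOf_mk_dvd_geomSum_div k.succ_ne_zero hs1 ho1 g ha
  have h2 : ∀ a ∈ elementOrders (PSL (k + 1) F), s2 ∣ a →
      a ∣ (Nat.card F ^ k - 1) / (k + 1).gcd (Nat.card F - 1) := by
    rintro _ ⟨x, rfl⟩ ha
    obtain ⟨g, rfl⟩ := QuotientGroup.mk_surjective x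
    exact orderOf_mk_dvd_pow_sub_one_div (by lia) hs2 ho2 g ha
  have hco := Nat.coprime_geomSum_div hq2 k
  refine ⟨⟨fun h ↦ ?_, fun ⟨r, hr, hr1, hr2⟩ ↦ ?_⟩,
    ⟨geomSum_div_gcd_mem_elementOrders k.succ_ne_zero, h1⟩,
    ⟨pow_sub_one_div_gcd_mem_elementOrders (by lia), h2⟩⟩
  · exact Nat.not_coprime_of_dvd_of_dvd hs1.one_lt
      ((dvd_mul_right s1 s2).trans (h1 _ h (dvd_mul_right s1 s2)))
      ((dvd_mul_right s1 s2).trans (h2 _ h (dvd_mul_left s2 s1))) hco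
  · exact Nat.not_coprime_of_dvd_of_dvd hr.one_lt
      ((dvd_mul_right r s1).trans (h1 _ hr1 (dvd_mul_left s1 r)))
      ((dvd_mul_right r s2).trans (h2 _ hr2 (dvd_mul_left s2 r))) hco
end
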